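/- arXiv:1504.00503 — 6 statements merged into one kernel-verified Lean document; each statement's English description precedes it below -/
import Mathlib

section
/- Let q be a prime power, r ≥ 2 an integer, a ∈ F\{0} and b ∈ F with b^q ≠ b, where F = GF(q²). Then the set B(a,b) has exactly q^{2r−1} points. -/
open Finset

/-- The affine point set `B(a,b) ⊆ AG(r,q²)`: a point of `F^r` is encoded as a pair
consisting of its first `r - 1` coordinates `(x₁, …, x_{r-1})` together with its last
coordinate `x_r`.  It consists of the solutions of
`x_r^q − x_r + a^q(x₁^{2q}+⋯+x_{r−1}^{2q}) − a(x₁²+⋯+x_{r−1}²)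
  = (b^q − b)(x₁^{q+1}+⋯+x_{r−1}^{q+1})`. -/
def BSet (q r : ℕ) {F : Type*} [Field F] (a b : F) :
    Set ((Fin (r - 1) → F) × F) :=
  {x | x.2 ^ q - x.2 + a ^ q * (∑ i, x.1 i ^ (2 * q)) - a * (∑ i, x.1 i ^ 2)
      = (b ^ q - b) * ∑ i, x.1 i ^ (q + 1)}

theorem exists_frob (q : ℕ) (hq : IsPrimePow q) {F : Type*} [Field F] [Fintype F]
    (hF : Fintype.card F = q ^ 2) : ∃ f : F →+* F, ∀ x, f x = x ^ q := by
  obtain ⟨p, n, hp, hn, rfl⟩ := hq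
  have hp' : p.Prime := hp.nat_prime
  haveI : Fact p.Prime := ⟨hp'⟩
  obtain ⟨c, hc⟩ := CharP.exists F
  obtain ⟨m, hcp, hm⟩ := FiniteField.card F c
  have hdvd : c ∣ p := by
    have h1 : c ∣ (p ^ n) ^ 2 := by
      rw [← hF, hm]; exact dvd_pow_self _ m.ne_zero
    exact hcp.dvd_of_dvd_pow (hcp.dvd_of_dvd_pow h1)
  have hcp2 : c = p := (Nat.prime_dvd_prime_iff_eq hcp hp').1 hdvd
  subst hcp2
  exact ⟨iterateFrobenius F c n, fun x => iterateFrobenius_def _ _ _⟩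

theorem card_roots_le (q : ℕ) (hq : 1 < q) {F : Type*} [Field F] [Fintype F] (c : F) :
    Nat.card {x : F | x ^ q = c * x} ≤ q := by
  classical
  let P : Polynomial F := Polynomial.X ^ q - Polynomial.C c * Polynomial.X
  have hdl : (Polynomial.C c * Polynomial.X : Polynomial F).degree < (q : WithBot ℕ) :=
    lt_of_le_of_lt (Polynomial.degree_C_mul_X_le c) (by exact_mod_cast hq)
  have hd : P.natDegree = q := by
    apply Polynomial.natDegree_eq_of_degree_eq_some
    have := Polynomial.degree_sub_eq_left_of_degree_lt
      (p := (Polynomial.X ^ q : Polynomial F)) (q := Polynomial.C c * Polynomial.X)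
      (by rw [Polynomial.degree_X_pow]; exact hdl)
    rw [this, Polynomial.degree_X_pow]
  have hP : P ≠ 0 := by
    intro h
    rw [h] at hd
    simp at hd
    omega
  have hs : {x : F | x ^ q = c * x} ⊆ (P.roots.toFinset : Set F) := by
    intro x hx
    simp only [Set.mem_setOf_eq] at hx
    simp [P, hP, Polynomial.mem_roots', hx]
  calc Nat.card {x : F | x ^ q = c * x} = Set.ncard {x : F | x ^ q = c * x} := rfl
    _ ≤ Set.ncard (P.roots.toFinset : Set F) := Set.ncard_le_ncard hs (Finset.finite_toSet _)
    _ = P.roots.toFinset.card := Set.ncard_coe_finset _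
    _ ≤ P.roots.card := Multiset.toFinset_card_le _
    _ ≤ q := hd ▸ Polynomial.card_roots' P

theorem card_fixed (q : ℕ) (hq : IsPrimePow q) {F : Type*} [Field F] [Fintype F]
    (hF : Fintype.card F = q ^ 2) : Nat.card {x : F | x ^ q = x} = q := by
  obtain ⟨f, hf⟩ := exists_frob q hq hF
  have hff : ∀ x : F, f (f x) = x := by
    intro x
    rw [hf, hf, ← pow_mul, ← sq, ← hF, FiniteField.pow_card]
  let g : F →+ F := f.toAddMonoidHom - AddMonoidHom.id F
  have hg : ∀ x, g x = f x - x := fun x => rfl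
  have hk : Nat.card g.ker = Nat.card {x : F | x ^ q = x} := by
    apply Nat.card_congr
    apply Equiv.subtypeEquivRight
    intro x
    rw [AddMonoidHom.mem_ker, hg, hf, sub_eq_zero]; rfl
  have h1 : Nat.card g.ker ≤ q := by
    rw [hk]; simpa using card_roots_le q hq.one_lt (1 : F)
  have h2 : Nat.card g.range ≤ q := by
    refine le_trans ?_ (card_roots_le q hq.one_lt (-1 : F))
    apply Nat.card_mono (Set.toFinite _)
    rintro _ ⟨x, rfl⟩
    simp only [Set.mem_setOf_eq]
    rw [← hf, hg, map_sub, hff]; ring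
  have h3 : Nat.card g.ker * Nat.card g.range = q ^ 2 := by
    rw [← hF, ← Nat.card_eq_fintype_card, ← g.ker.card_mul_index, AddSubgroup.index_ker]
  have := hq.pos
  rw [← hk]
  nlinarith

/-- `B(a,b)` has exactly `q^{2r−1}` points. -/
theorem statement1 (q r : ℕ) (hq : IsPrimePow q) (hr : 2 ≤ r)
    {F : Type*} [Field F] [Fintype F] (hF : Fintype.card F = q ^ 2)
    (a b : F) (ha : a ≠ 0) (hb : b ^ q ≠ b) :
    (BSet q r a b).ncard = q ^ (2 * r - 1) := by
  obtain ⟨f, hf⟩ := exists_frob q hq hF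
  have hff : ∀ x : F, f (f x) = x := by
    intro x
    rw [hf, hf, ← pow_mul, ← sq, ← hF, FiniteField.pow_card]
  let T : (Fin (r - 1) → F) → F := fun x => a * (∑ i, x i ^ 2) - b * ∑ i, x i ^ (q + 1)
  have key : ∀ x : (Fin (r - 1) → F) × F,
      x ∈ BSet q r a b ↔ (x.2 + T x.1) ^ q = x.2 + T x.1 := by
    intro x
    have e1 : f (∑ i, x.1 i ^ (q + 1)) = ∑ i, x.1 i ^ (q + 1) := by
      rw [map_sum]
      refine Finset.sum_congr rfl fun i _ => ?_
      rw [pow_succ, ← hf, map_mul, hff, mul_comm]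
    have e2 : f (∑ i, x.1 i ^ 2) = ∑ i, x.1 i ^ (2 * q) := by
      rw [map_sum]
      refine Finset.sum_congr rfl fun i _ => ?_
      rw [hf, pow_mul]
    have e3 : f (x.2 + T x.1) = x.2 ^ q + (a ^ q * (∑ i, x.1 i ^ (2 * q))
        - b ^ q * ∑ i, x.1 i ^ (q + 1)) := by
      simp only [T]
      rw [map_add, map_sub, map_mul, map_mul, e1, e2, hf, hf, hf]
    rw [← hf, e3]
    simp only [BSet, Set.mem_setOf_eq, T]
    constructor
    · intro h; linear_combination h
    · intro h; linear_combination h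
  let e : BSet q r a b ≃ (Fin (r - 1) → F) × {x : F | x ^ q = x} :=
    { toFun := fun x => (x.1.1, ⟨x.1.2 + T x.1.1, (key x.1).1 x.2⟩)
      invFun := fun y => ⟨(y.1, y.2.1 - T y.1), (key _).2 (by
        have := y.2.2
        simp only [Set.mem_setOf_eq] at this
        simpa using this)⟩
      left_inv := fun x => by simp
      right_inv := fun y => by simp }
  have hc : (BSet q r a b).ncard = Nat.card (BSet q r a b) := rfl
  rw [hc, Nat.card_congr e, Nat.card_prod, card_fixed q hq hF, Nat.card_fun, Nat.card_eq_fintype_card,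
    Nat.card_eq_fintype_card, hF, Fintype.card_fin, ← pow_mul, ← pow_succ]
  congr 1
  omega
end

section
/- Let q be a prime power, r ≥ 2 an integer, a ∈ F\{0} and b ∈ F with b^q ≠ b, where F = GF(q²). Every affine hyperplane of F^r of the form {x ∈ F^r : c₁x₁ + ⋯ + c_{r−1}x_{r−1} = d} with (c₁,…,c_{r−1}) ≠ (0,…,0) (i.e., every affine hyperplane containing the direction (0,…,0,1), equivalently passing through the infinite point P∞ = (0,…,0,1)) meets B(a,b) in exactly q^{2r−3} points. -/
open Finset

lemma aux_fiber {G H : Type*} [AddCommGroup G] [AddCommGroup H] [Finite G]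
    (f : G →+ H) (g : G) : {x | f x = f g}.ncard = Nat.card f.ker := by
  rw [← Nat.card_coe_set_eq]
  refine Nat.card_congr ⟨fun x => ⟨x.1 - g, ?_⟩, fun x => ⟨x.1 + g, ?_⟩, ?_, ?_⟩
  · have := x.2
    simp only [Set.mem_ofPred_eq] at this
    simp [AddMonoidHom.mem_ker, this]
  · have := x.2
    rw [AddMonoidHom.mem_ker] at this
    simp [this]
  · intro x; simp
  · intro x; simp

lemma aux_card {G H : Type*} [AddCommGroup G] [AddCommGroup H] [Finite G]
    (f : G →+ H) : Nat.card f.ker * Nat.card f.range = Nat.card G := by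
  rw [mul_comm, AddSubgroup.card_eq_card_quotient_mul_card_addSubgroup f.ker,
    Nat.card_congr (QuotientAddGroup.quotientKerEquivRange f).toEquiv]

lemma aux_roots {F : Type*} [Field F] (q : ℕ) (hq : 1 < q) (e : F) :
    {x : F | x ^ q + e * x = 0}.ncard ≤ q := by
  classical
  set P : Polynomial F := Polynomial.X ^ q + Polynomial.C e * Polynomial.X with hP
  have hlt : (Polynomial.C e * Polynomial.X : Polynomial F).degree < q :=
    lt_of_le_of_lt (Polynomial.degree_C_mul_X_le e) (by exact_mod_cast hq)
  have hdeg : P.degree = q := by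
    rw [hP, Polynomial.degree_add_eq_left_of_degree_lt, Polynomial.degree_X_pow]
    rwa [Polynomial.degree_X_pow]
  have h0 : P ≠ 0 := by
    intro h; rw [h] at hdeg; simp at hdeg
  have hn : P.natDegree = q := Polynomial.natDegree_eq_of_degree_eq_some hdeg
  have : {x : F | x ^ q + e * x = 0} = (P.roots.toFinset : Set F) := by
    ext x
    rw [Finset.mem_coe, Multiset.mem_toFinset, Polynomial.mem_roots h0]
    simp [hP]
  rw [this, Set.ncard_coe_finset]
  calc _ ≤ Multiset.card P.roots := Multiset.toFinset_card_le _
    _ ≤ P.natDegree := Polynomial.card_roots' P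
    _ = q := hn

/-- every affine hyperplane `c₁x₁ + ⋯ + c_{r−1}x_{r−1} = d` with
`(c₁,…,c_{r−1}) ≠ 0` (i.e. every affine hyperplane through the infinite point
`P∞ = (0,…,0,1)`) meets `B(a,b)` in exactly `q^{2r−3}` points. -/
theorem statement2 (q r : ℕ) (hq : IsPrimePow q) (hr : 2 ≤ r)
    {F : Type*} [Field F] [Fintype F] (hF : Fintype.card F = q ^ 2)
    (a b : F) (ha : a ≠ 0) (hb : b ^ q ≠ b) :
    ∀ (c : Fin (r - 1) → F) (d : F), c ≠ 0 →
      (({x : (Fin (r - 1) → F) × F | ∑ i, c i * x.1 i = d} ∩ BSet q r a b)).ncard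
        = q ^ (2 * r - 3) := by
  intro c d hc
  have hq1 : 1 < q := hq.one_lt
  obtain ⟨φ, hφ⟩ : ∃ φ : F →+* F, ∀ x, φ x = x ^ q := by
    obtain ⟨p, k, hp, hk, rfl⟩ := (isPrimePow_nat_iff q).1 hq
    have : Fact p.Prime := ⟨hp⟩
    have : CharP F p := by
      refine charP_of_card_eq_prime_pow (f := k * 2) ?_
      rw [hF, pow_mul]
    exact ⟨iterateFrobenius F p k, fun x => iterateFrobenius_def p k x⟩
  have hφφ : ∀ x, φ (φ x) = x := by
    intro x
    rw [hφ, hφ, ← pow_mul, ← sq, ← hF, FiniteField.pow_card]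
  -- fixed points
  have hK : {t : F | φ t = t}.ncard = q := by
    let g : F →+ F := φ.toAddMonoidHom - AddMonoidHom.id F
    have hg : ∀ x, g x = φ x - x := fun x => rfl
    have h1 := aux_card g
    have h2 : {t : F | φ t = t}.ncard = Nat.card g.ker := by
      rw [← Nat.card_coe_set_eq]
      refine Nat.card_congr (Equiv.subtypeEquivRight fun x => ?_)
      rw [AddMonoidHom.mem_ker, hg, sub_eq_zero]; rfl
    have h3 : {t : F | φ t = t}.ncard ≤ q := by
      refine le_trans (le_of_eq ?_) (aux_roots (F := F) q hq1 (-1))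
      congr 1; ext x
      simp only [Set.mem_ofPred_eq, hφ]
      rw [neg_one_mul, ← sub_eq_add_neg, sub_eq_zero]
    have h4 : Nat.card g.range ≤ q := by
      refine le_trans ?_ (aux_roots (F := F) q hq1 1)
      rw [← Nat.card_coe_set_eq]
      refine Nat.card_mono (Set.toFinite _) (s := (g.range : Set F)) ?_
      rintro _ ⟨x, rfl⟩
      simp only [Set.mem_ofPred_eq]
      rw [← hφ, hg, map_sub, hφφ]; ring
    rw [Nat.card_eq_fintype_card (α := F), hF, ← h2] at h1
    nlinarith
  -- hyperplane
  have hH : {x : Fin (r - 1) → F | ∑ i, c i * x i = d}.ncard = q ^ (2 * r - 4) := by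
    let L : (Fin (r - 1) → F) →+ F :=
      { toFun := fun x => ∑ i, c i * x i
        map_zero' := by simp
        map_add' := by intro x y; simp [mul_add, Finset.sum_add_distrib] }
    have hL : ∀ x, L x = ∑ i, c i * x i := fun x => rfl
    have hs : Function.Surjective L := by
      intro y
      obtain ⟨i, hi⟩ := Function.ne_iff.1 hc
      have hi' : c i ≠ 0 := hi
      refine ⟨Pi.single i (y / c i), ?_⟩
      rw [hL, Finset.sum_eq_single i]
      · simp; field_simp
      · intro j _ hj; simp [hj]
      · simp
    obtain ⟨g, hg⟩ := hs d
    have h1 := aux_fiber L g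
    have h2 := aux_card L
    rw [AddMonoidHom.range_eq_top.2 hs] at h2
    rw [hg] at h1
    have h3 : {x : Fin (r - 1) → F | ∑ i, c i * x i = d}.ncard = Nat.card L.ker := h1
    rw [h3]
    have h5 : Nat.card L.ker * q ^ 2 = q ^ (2 * r - 4) * q ^ 2 := by
      rw [← pow_add, ← hF]
      have : Nat.card (⊤ : AddSubgroup F) = Fintype.card F := by simp
      rw [← this, h2]
      simp [hF, ← pow_mul]
      congr 1; omega
    exact Nat.eq_of_mul_eq_mul_right (by positivity) h5
  -- bijection
  let u : (Fin (r - 1) → F) → F := fun x => b * ∑ i, x i ^ (q + 1) - a * ∑ i, x i ^ 2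
  have hu : ∀ x y, ((x, y) ∈ BSet q r a b ↔ φ (y - u x) = y - u x) := by
    intro x y
    have hN : φ (∑ i, x i ^ (q + 1)) = ∑ i, x i ^ (q + 1) := by
      rw [map_sum]
      refine Finset.sum_congr rfl fun i _ => ?_
      rw [pow_succ, map_mul, ← hφ, hφφ, mul_comm]
    have hS : φ (∑ i, x i ^ 2) = ∑ i, x i ^ (2 * q) := by
      rw [map_sum]
      refine Finset.sum_congr rfl fun i _ => ?_
      rw [hφ, pow_mul]
    simp only [BSet, Set.mem_ofPred_eq, u, map_sub, map_mul, hN, hS]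
    rw [hφ y, hφ a, hφ b]
    constructor <;> intro h <;> linear_combination h
  have : ({x : (Fin (r - 1) → F) × F | ∑ i, c i * x.1 i = d} ∩ BSet q r a b)
      = (fun z : (Fin (r - 1) → F) × F => (z.1, z.2 + u z.1)) ''
        ({x : Fin (r - 1) → F | ∑ i, c i * x i = d} ×ˢ {t : F | φ t = t}) := by
    ext ⟨x, y⟩
    rw [Set.mem_inter_iff, hu]
    constructor
    · rintro ⟨h1, h2⟩
      exact ⟨(x, y - u x), ⟨h1, h2⟩, by simp⟩
    · rintro ⟨⟨x', t⟩, ⟨h1, h2⟩, h⟩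
      simp only [Prod.mk.injEq] at h
      obtain ⟨rfl, rfl⟩ := h
      refine ⟨h1, ?_⟩
      simpa using h2
  rw [this, Set.ncard_image_of_injective, Set.ncard_prod, hH, hK, ← pow_succ]
  · congr 1; omega
  · rintro ⟨x, t⟩ ⟨x', t'⟩ h
    simp only [Prod.mk.injEq] at h
    obtain ⟨rfl, h⟩ := h
    simpa using h
end

section
/- Let q be an odd prime power, r ≥ 3 an odd integer such that r ≡ 1 (mod 4) or q ≡ 1 (mod 4), a ∈ F\{0} and b ∈ F with b^q ≠ b, where F = GF(q²), and suppose 4a^{q+1} + (b^q − b)² = 0. Then B(a,b) has exactly q^{2r−1} points and for every affine hyperplane π of F^r the cardinality |π ∩ B(a,b)| belongs to the set { q^{2r−3} − q^{(3r−5)/2}, q^{2r−3}, q^{2r−3} − q^{(3r−5)/2} + q^{3(r−1)/2} }. -/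
open Finset

open Classical in
/-- number of solutions of `f x = y`, as an integer -/
noncomputable def cnt {X Y : Type*} [Fintype X] (f : X → Y) (y : Y) : ℤ :=
  ∑ x, if f x = y then 1 else 0

theorem cnt_sum {X Y : Type*} [Fintype X] [Fintype Y] (f : X → Y) :
    ∑ y, cnt f y = Fintype.card X := by
  classical
  unfold cnt
  rw [Finset.sum_comm]
  simp

theorem cnt_comp {X X' Y : Type*} [Fintype X] [Fintype X'] (e : X ≃ X') (f : X' → Y) (y : Y) :
    cnt (fun x => f (e x)) y = cnt f y := by
  unfold cnt
  exact Fintype.sum_equiv e _ _ (fun x => rfl)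

theorem cnt_const {X Y : Type*} [Fintype X] [Fintype Y] (f : X → Y)
    (h : ∀ y y', cnt f y = cnt f y') (y : Y) :
    Fintype.card Y * cnt f y = Fintype.card X := by
  rw [← cnt_sum f, Finset.sum_congr rfl (fun y' _ => h y' y)]
  simp

/-- fibres over a composite -/
theorem cnt_fib {X Z Y : Type*} [Fintype X] [Fintype Z] (g : X → Z) (f : Z → Y) (c : ℤ)
    (hg : ∀ z, cnt g z = c) (y : Y) :
    cnt (fun x => f (g x)) y = c * cnt f y := by
  classical
  unfold cnt at *
  rw [Finset.mul_sum]
  have : ∀ x, (if f (g x) = y then (1:ℤ) else 0)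
      = ∑ z, if g x = z then (if f z = y then 1 else 0) else 0 := by
    intro x; simp
  rw [Finset.sum_congr rfl (fun x _ => this x), Finset.sum_comm]
  refine Finset.sum_congr rfl fun z _ => ?_
  rw [← hg z, Finset.sum_mul]
  refine Finset.sum_congr rfl fun x _ => ?_
  by_cases h : g x = z <;> simp [h]

/-- shifts -/
theorem cnt_shift {X Y : Type*} [Fintype X] [Fintype Y] [AddGroup Y] (f : X → Y)
    (h : ∀ k : Y, ∃ e : X ≃ X, ∀ x, f (e x) = f x + k) (y : Y) :
    Fintype.card Y * cnt f y = Fintype.card X := by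
  apply cnt_const
  intro y y'
  obtain ⟨e, he⟩ := h (-y' + y)
  rw [← cnt_comp e f y]
  unfold cnt
  refine Finset.sum_congr rfl fun x _ => ?_
  have : f (e x) = y ↔ f x = y' := by
    rw [he]
    constructor
    · intro h
      have := congrArg (· - (-y' + y)) h
      simpa [sub_eq_add_neg, add_assoc] using this
    · intro h; rw [h]; simp
  by_cases hx : f x = y'
  · rw [if_pos hx, if_pos (this.2 hx)]
  · rw [if_neg hx, if_neg (fun h => hx (this.1 h))]

theorem cnt_hom {X Y : Type*} [Fintype X] [Fintype Y] [AddCommGroup X] [AddCommGroup Y]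
    (f : X →+ Y) (h : Function.Surjective f) (y : Y) :
    Fintype.card Y * cnt f y = Fintype.card X := by
  apply cnt_shift
  intro k
  obtain ⟨w, hw⟩ := h k
  exact ⟨Equiv.addRight w, fun x => by simp [hw]⟩

theorem cnt_ncard {X Y : Type*} [Fintype X] (f : X → Y) (y : Y) :
    cnt f y = ({x | f x = y} : Set X).ncard := by
  classical
  unfold cnt
  rw [Set.ncard_eq_toFinset_card']
  simp

theorem cnt_congr {X Y Y' : Type*} [Fintype X] {f : X → Y} {g : X → Y'} {y : Y} {y' : Y'}
    (h : ∀ x, f x = y ↔ g x = y') : cnt f y = cnt g y' := by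
  rw [cnt_ncard, cnt_ncard]
  congr 2
  ext x
  exact h x

/-! two squares -/
section
variable {K : Type*} [Field K] [Fintype K]

theorem exists_two_sq (h2 : (2:K) ≠ 0) (δ : K) : ∃ x y : K, x ^ 2 + y ^ 2 = δ := by
  obtain ⟨x, y, h⟩ := FiniteField.exists_root_sum_quadratic (R := K)
    (f := Polynomial.X ^ 2) (g := Polynomial.X ^ 2 - Polynomial.C δ) (Polynomial.degree_X_pow 2)
    (Polynomial.degree_X_pow_sub_C (by decide) _)
    (FiniteField.odd_card_of_char_ne_two (fun h => h2 (by
      have := ringChar.Nat.cast_ringChar (R := K)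
      rw [h] at this; exact_mod_cast this)))
  refine ⟨x, y, ?_⟩
  simp at h
  linear_combination h

theorem two_sq_const (h2 : (2:K) ≠ 0) (δ : K) (hδ : δ ≠ 0) :
    cnt (fun p : K × K => p.1 ^ 2 + p.2 ^ 2) δ = cnt (fun p : K × K => p.1 ^ 2 + p.2 ^ 2) 1 := by
  obtain ⟨a, b, h⟩ := exists_two_sq h2 δ
  let e : K × K ≃ K × K :=
    { toFun := fun p => (a * p.1 - b * p.2, b * p.1 + a * p.2)
      invFun := fun p => ((a * p.1 + b * p.2) / δ, (a * p.2 - b * p.1) / δ)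
      left_inv := by
        rintro ⟨x, y⟩
        ext
        · simp only; field_simp; rw [← h]; ring
        · simp only; field_simp; rw [← h]; ring
      right_inv := by
        rintro ⟨x, y⟩
        ext
        · simp only; field_simp; rw [← h]; ring
        · simp only; field_simp; rw [← h]; ring }
  rw [← cnt_comp e]
  unfold cnt
  refine Finset.sum_congr rfl fun p _ => ?_
  have : (e p).1 ^ 2 + (e p).2 ^ 2 = δ ↔ p.1 ^ 2 + p.2 ^ 2 = 1 := by
    have : (e p).1 ^ 2 + (e p).2 ^ 2 = δ * (p.1 ^ 2 + p.2 ^ 2) := by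
      simp only [e, Equiv.coe_fn_mk]; rw [← h]; ring
    rw [this]
    constructor
    · intro h; exact mul_left_cancel₀ hδ (by rw [h, mul_one])
    · intro h; rw [h, mul_one]
  by_cases hx : p.1 ^ 2 + p.2 ^ 2 = 1
  · rw [if_pos hx, if_pos (this.2 hx)]
  · rw [if_neg hx, if_neg (fun h => hx (this.1 h))]

theorem two_sq_zero_neg (hi : ¬ IsSquare (-1 : K)) :
    cnt (fun p : K × K => p.1 ^ 2 + p.2 ^ 2) 0 = 1 := by
  classical
  unfold cnt
  rw [Finset.sum_eq_single (0, 0)]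
  · simp
  · rintro ⟨x, y⟩ - hxy
    rw [if_neg]
    simp only
    intro h
    by_cases hx : x = 0
    · subst hx
      apply hxy
      have : y = 0 := by simpa using h
      rw [this]
    · apply hi
      refine ⟨y / x, ?_⟩
      field_simp
      linear_combination -h
  · simp

theorem two_sq_zero_pos (h2 : (2:K) ≠ 0) (hi : IsSquare (-1 : K)) :
    cnt (fun p : K × K => p.1 ^ 2 + p.2 ^ 2) 0 = 2 * Fintype.card K - 1 := by
  classical
  obtain ⟨i, hi⟩ := hi
  have hi0 : i ≠ 0 := by rintro rfl; simp at hi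
  unfold cnt
  have key : ∀ p : K × K, (if p.1 ^ 2 + p.2 ^ 2 = 0 then (1:ℤ) else 0) =
      (if p.2 = i * p.1 then 1 else 0) + (if p.2 = -i * p.1 then 1 else 0) -
      (if p.2 = 0 then (if p.1 = 0 then 1 else 0) else 0) := by
    rintro ⟨x, y⟩
    simp only
    by_cases hx : x = 0
    · subst hx
      by_cases hy : y = 0 <;> simp [hy]
    · have h1 : x ^ 2 + y ^ 2 = 0 ↔ (y = i * x ∨ y = -i * x) := by
        have : x ^ 2 + y ^ 2 = (y - i * x) * (y - -i * x) := by linear_combination - x^2 * hi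
        rw [this, mul_eq_zero, sub_eq_zero, sub_eq_zero]
      have h3 : i * x ≠ -i * x := by
        intro h
        have : 2 * (i * x) = 0 := by linear_combination h
        simp [h2, hi0, hx] at this
      by_cases hA : y = i * x
      · have hB : y ≠ -i * x := by rw [hA]; exact h3
        rw [if_pos (h1.2 (Or.inl hA)), if_pos hA, if_neg hB]; simp [hx]
      · by_cases hB : y = -i * x
        · rw [if_pos (h1.2 (Or.inr hB)), if_neg hA, if_pos hB]; simp [hx]
        · rw [if_neg (by rw [h1]; tauto), if_neg hA, if_neg hB]; simp [hx]
  rw [Finset.sum_congr rfl (fun p _ => key p), Finset.sum_sub_distrib, Finset.sum_add_distrib]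
  simp only [Fintype.sum_prod_type]
  simp
  ring

open Classical in
theorem two_sq (h2 : (2:K) ≠ 0) :
    ∃ η : ℤ, (η = 1 ∨ η = -1) ∧ (Fintype.card K % 4 = 1 → η = 1) ∧
    ∀ δ : K, cnt (fun p : K × K => p.1 ^ 2 + p.2 ^ 2) δ =
      Fintype.card K - η + η * Fintype.card K * (if δ = 0 then 1 else 0) := by
  have hc : (1:ℤ) < Fintype.card K := by exact_mod_cast Fintype.one_lt_card
  have hsum := cnt_sum (fun p : K × K => p.1 ^ 2 + p.2 ^ 2)
  rw [Fintype.sum_eq_add_sum_compl 0, Finset.sum_congr rfl (fun y hy =>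
    two_sq_const h2 y (by simpa using hy))] at hsum
  simp only [Finset.sum_const, Finset.card_compl, Finset.card_singleton, Fintype.card_prod,
    nsmul_eq_mul, Nat.cast_mul] at hsum
  rw [Nat.cast_sub (by exact_mod_cast hc.le)] at hsum
  push_cast at hsum
  by_cases hi : IsSquare (-1 : K)
  · refine ⟨1, Or.inl rfl, fun _ => rfl, fun δ => ?_⟩
    have h0 := two_sq_zero_pos h2 hi
    by_cases hδ : δ = 0
    · rw [hδ, h0]; simp; ring
    · rw [two_sq_const h2 δ hδ, if_neg hδ]
      rw [h0] at hsum
      have : ((Fintype.card K : ℤ) - 1) ≠ 0 := by omega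
      apply mul_left_cancel₀ this
      linear_combination hsum
  · refine ⟨-1, Or.inr rfl, fun h => ?_, fun δ => ?_⟩
    · exact absurd (FiniteField.isSquare_neg_one_iff.2 (by omega)) hi
    have h0 := two_sq_zero_neg hi
    by_cases hδ : δ = 0
    · rw [hδ, h0]; simp
    · rw [two_sq_const h2 δ hδ, if_neg hδ]
      rw [h0] at hsum
      have : ((Fintype.card K : ℤ) - 1) ≠ 0 := by omega
      apply mul_left_cancel₀ this
      linear_combination hsum

/-- convolution -/
theorem cnt_conv {X Y G : Type*} [Fintype X] [Fintype Y] [Fintype G] [AddCommGroup G]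
    (f : X → G) (g : Y → G) (δ : G) :
    cnt (fun p : X × Y => f p.1 + g p.2) δ = ∑ γ, cnt f γ * cnt g (δ - γ) := by
  classical
  unfold cnt
  simp only [Fintype.sum_prod_type, Finset.sum_mul]
  conv_rhs => rw [Finset.sum_comm]
  refine Finset.sum_congr rfl fun x _ => ?_
  simp only [ite_mul, one_mul, zero_mul, Finset.sum_ite_eq, Finset.mem_univ, if_true]
  refine Finset.sum_congr rfl fun y _ => ?_
  congr 1
  rw [eq_sub_iff_add_eq, add_comm]

open Classical in
theorem sq_step (η : ℤ)
    (hη : ∀ δ : K, cnt (fun p : K × K => p.1 ^ 2 + p.2 ^ 2) δ =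
      Fintype.card K - η + η * Fintype.card K * (if δ = 0 then 1 else 0)) (m : ℕ) (δ : K) :
    (Fintype.card K : ℤ) * cnt (fun u : Fin (2 * m) → K => ∑ i, u i ^ 2) δ =
      Fintype.card K ^ (2 * m) +
        η ^ m * Fintype.card K ^ m * (Fintype.card K * (if δ = 0 then 1 else 0) - 1) := by
  induction m with
  | zero =>
    by_cases h : δ = 0
    · simp [cnt, h]
    · simp [cnt, h, Ne.symm h]
  | succ m ih =>
    let e : (K × K) × (Fin (2 * m) → K) ≃ (Fin (2 * (m + 1)) → K) :=
      (Equiv.prodAssoc _ _ _).trans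
      (((Equiv.refl K).prodCongr (Fin.consEquiv (fun _ : Fin (2 * m + 1) => K))).trans
        (Fin.consEquiv (fun _ : Fin (2 * m + 1 + 1) => K)))
    have he : ∀ x, ∑ i, (e x) i ^ 2 = (x.1.1 ^ 2 + x.1.2 ^ 2) + ∑ i, x.2 i ^ 2 := by
      intro x
      change (∑ i : Fin (2 * m + 1 + 1), (e x : Fin (2 * m + 1 + 1) → K) i ^ 2) = _
      rw [Fin.sum_univ_succ, Fin.sum_univ_succ]
      simp [e, Fin.consEquiv, add_assoc]
    rw [← cnt_comp e]
    simp only [he]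
    rw [cnt_conv (fun p : K × K => p.1 ^ 2 + p.2 ^ 2) (fun u : Fin (2 * m) → K => ∑ i, u i ^ 2)]
    simp only [hη, add_mul, Finset.sum_add_distrib, ← Finset.mul_sum]
    have h1 : ∑ γ, cnt (fun u : Fin (2 * m) → K => ∑ i, u i ^ 2) (δ - γ)
        = Fintype.card K ^ (2 * m) := by
      have := Equiv.sum_comp (Equiv.subLeft δ)
        (fun γ => cnt (fun u : Fin (2 * m) → K => ∑ i, u i ^ 2) γ)
      rw [cnt_sum] at this
      simpa using this
    rw [h1]
    simp only [mul_assoc, ← Finset.mul_sum, ite_mul, one_mul, zero_mul, Finset.sum_ite_eq',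
      Finset.mem_univ, if_true, sub_zero]
    linear_combination (η * Fintype.card K) * ih

theorem core (h2 : (2:K) ≠ 0) {V : Type*} [AddCommGroup V] [Fintype V] [Module K V]
    (hV : Fintype.card V = Fintype.card K ^ 2) (T : V →ₗ[K] K) (hT : Function.Surjective T)
    (m : ℕ) (hm : Even m ∨ Fintype.card K % 4 = 1) (S : Fin (2 * m) → V →ₗ[K] K) (δ : K) :
    let q : ℤ := Fintype.card K
    let N := cnt (fun z : Fin (2 * m) → V => ∑ i, (T (z i) ^ 2 - S i (z i))) δ
    q * N = q ^ (4 * m) ∨ q * N = q ^ (4 * m) - q ^ (3 * m) ∨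
      q * N = q ^ (4 * m) - q ^ (3 * m) + q ^ (3 * m + 1) := by
  classical
  intro q N
  have hq0 : q ≠ 0 := by simp [q]
  by_cases hA : ∃ i w, T w = 0 ∧ S i w ≠ 0
  · left
    obtain ⟨i, w, hw, hS⟩ := hA
    have := cnt_shift (fun z : Fin (2 * m) → V => ∑ i, (T (z i) ^ 2 - S i (z i))) (fun k => by
      refine ⟨Equiv.addRight (Pi.single i (-(k / S i w) • w)), fun x => ?_⟩
      have h1 : ∀ j, T ((Pi.single i (-(k / S i w) • w) : Fin (2 * m) → V) j) = 0 := by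
        intro j
        by_cases hj : j = i
        · subst hj; simp [hw]
        · simp [hj]
      have h3 : ∀ j, S j ((Pi.single i (-(k / S i w) • w) : Fin (2 * m) → V) j)
          = if j = i then -k else 0 := by
        intro j
        by_cases hj : j = i
        · subst hj; simp [hS]
        · simp [hj]
      simp only [Equiv.coe_addRight, Pi.add_apply, map_add, h1, h3, add_zero]
      simp only [← sub_sub, Finset.sum_sub_distrib (f := fun j => T (x j) ^ 2 - S j (x j))]
      simp) δ
    change q * N = _ at this
    rw [this]
    simp only [Fintype.card_pi, hV, Finset.prod_const, Finset.card_univ, Fintype.card_fin]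
    push_cast
    change (q ^ 2) ^ (2 * m) = _
    ring
  · right
    push Not at hA
    obtain ⟨w0, hw0⟩ := hT 1
    have hk : ∀ i w, S i w = S i w0 * T w := by
      intro i w
      have := hA i (w - T w • w0) (by simp [hw0])
      simp at this
      linear_combination this
    obtain ⟨η, hη1, hη2, hη⟩ := two_sq h2
    have hηm : η ^ m = 1 := by
      rcases hm with hm | hm
      · rcases hη1 with h | h
        · simp [h]
        · rw [h, hm.neg_one_pow]
      · simp [hη2 hm]
    set κ : K := ∑ i, (S i w0) ^ 2 / 4 with hκ
    have h4 : (4:K) ≠ 0 := by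
      have : (4:K) = 2 * 2 := by norm_num
      rw [this]; exact mul_ne_zero h2 h2
    have hN : N = cnt (fun z : Fin (2 * m) → V =>
        (fun u : Fin (2 * m) → K => ∑ i, u i ^ 2) (fun i => T (z i) - S i w0 / 2)) (δ + κ) := by
      apply cnt_congr
      intro z
      have : ∑ i, (T (z i) - S i w0 / 2) ^ 2 = ∑ i, (T (z i) ^ 2 - S i (z i)) + κ := by
        rw [hκ, ← Finset.sum_add_distrib]
        refine Finset.sum_congr rfl fun i _ => ?_
        rw [hk i (z i)]
        field_simp
        ring
      simp only [this]
      exact (add_left_inj κ).symm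
    have hfib : ∀ u, cnt (fun (z : Fin (2 * m) → V) (i : Fin (2 * m)) => T (z i) - S i w0 / 2) u
        = q ^ (2 * m) := by
      intro u
      have h1 : cnt (fun (z : Fin (2 * m) → V) (i : Fin (2 * m)) => T (z i) - S i w0 / 2) u
        = cnt (AddMonoidHom.compLeft T.toAddMonoidHom (Fin (2 * m)))
            (fun i => u i + S i w0 / 2) := by
        apply cnt_congr
        intro z
        simp only [funext_iff, sub_eq_iff_eq_add]
        rfl
      rw [h1]
      have h3 := cnt_hom (AddMonoidHom.compLeft T.toAddMonoidHom (Fin (2 * m))) (by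
        intro v
        choose g hg using hT
        exact ⟨fun i => g (v i), by ext i; simp [hg]⟩) (fun i => u i + S i w0 / 2)
      simp only [Fintype.card_pi, hV, Finset.prod_const, Finset.card_univ, Fintype.card_fin] at h3
      push_cast at h3
      change q ^ (2 * m) * _ = (q ^ 2) ^ (2 * m) at h3
      apply mul_left_cancel₀ (pow_ne_zero (2 * m) hq0)
      rw [h3]; ring
    replace hN := hN.trans (cnt_fib (fun (z : Fin (2 * m) → V) (i : Fin (2 * m)) =>
      T (z i) - S i w0 / 2) (fun u : Fin (2 * m) → K => ∑ i, u i ^ 2) _ hfib _)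
    have h5 := sq_step η hη m (δ + κ)
    rw [hηm] at h5
    change q * _ = q ^ (2 * m) + 1 * q ^ m * (q * _ - 1) at h5
    have h6 : q * N = q ^ (2 * m) * (q ^ (2 * m) + 1 * q ^ m *
        (q * (if δ + κ = 0 then 1 else 0) - 1)) := by
      rw [← h5, hN]; ring
    rw [h6]
    by_cases hz : δ + κ = 0
    · right; rw [if_pos hz]; ring
    · left; rw [if_neg hz]; ring

end

/-! the quadratic extension -/
section
variable {F : Type*} [Field F] [Fintype F]

theorem card_ker_le (q : ℕ) (hq : 1 < q) (c : F) (f : F →+ F) (hf : ∀ x, f x = x ^ q + c * x) :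
    Nat.card f.ker ≤ q := by
  classical
  open Polynomial in
  have hd : (C c * X : F[X]).degree < (q : ℕ) := by
    refine (degree_C_mul_X_le c).trans_lt ?_
    exact_mod_cast hq
  have hm : (Polynomial.X ^ q + Polynomial.C c * Polynomial.X).Monic := Polynomial.monic_X_pow_add hd
  have hn : (Polynomial.X ^ q + Polynomial.C c * Polynomial.X).natDegree = q := by
    apply Polynomial.natDegree_eq_of_degree_eq_some
    rw [Polynomial.degree_add_eq_left_of_degree_lt] <;> simp only [Polynomial.degree_X_pow]
    exact hd
  have h1 := Polynomial.card_roots' (Polynomial.X ^ q + Polynomial.C c * Polynomial.X)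
  rw [hn] at h1
  refine le_trans ?_ ((Multiset.toFinset_card_le _).trans h1)
  rw [← Nat.card_eq_finsetCard]
  apply Nat.card_mono (Finset.finite_toSet _)
  intro x hx
  have : f x = 0 := hx
  rw [hf] at this
  simp [hm.ne_zero, this]

theorem quad_cards (q : ℕ) (hq : 1 < q) (hF : Fintype.card F = q ^ 2) (f g : F →+ F)
    (hfg : ∀ x, f (g x) = 0) (c d : F)
    (hf : ∀ x, f x = x ^ q + c * x) (hg : ∀ x, g x = x ^ q + d * x) :
    Nat.card f.ker = q ∧ g.range = f.ker := by
  have h1 := card_ker_le q hq c f hf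
  have h2 := card_ker_le q hq d g hg
  have h3 : g.range ≤ f.ker := by
    rintro _ ⟨x, rfl⟩
    exact hfg x
  have h4 : Nat.card g.ker * Nat.card g.range = q ^ 2 := by
    rw [← AddSubgroup.index_ker, AddSubgroup.card_mul_index, Nat.card_eq_fintype_card, hF]
  have h5 : Nat.card g.range ≤ Nat.card f.ker := Nat.card_mono (Set.toFinite _) h3
  have h6 : q ≤ Nat.card g.range := by
    by_contra h
    push Not at h
    have : Nat.card g.ker * Nat.card g.range < q * q :=
      lt_of_le_of_lt (Nat.mul_le_mul_right _ h2) ((Nat.mul_lt_mul_left (by omega)).2 h)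
    nlinarith
  have h7 : Nat.card f.ker = q := by omega
  refine ⟨h7, ?_⟩
  apply SetLike.coe_injective
  apply Set.eq_of_subset_of_ncard_le h3
  change Nat.card f.ker ≤ Nat.card g.range
  omega


theorem quad_frob (q : ℕ) (hq : IsPrimePow q) (hF : Fintype.card F = q ^ 2) :
    ∃ φ : F →+* F, (∀ x, φ x = x ^ q) ∧ ∀ x, φ (φ x) = x := by
  obtain ⟨p, k, hp, hk, rfl⟩ := hq
  have hp' : Nat.Prime p := hp.nat_prime
  have : Fact p.Prime := ⟨hp'⟩
  obtain ⟨p', hp2⟩ := CharP.exists F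
  have : CharP F p' := hp2
  obtain ⟨n, hp'p, hn⟩ := FiniteField.card F p'
  have : p' = p := by
    have h1 : p' ∣ (p ^ k) ^ 2 := by
      rw [← hF, hn]; exact dvd_pow_self _ n.ne_zero
    exact (Nat.prime_dvd_prime_iff_eq hp'p hp').1 (hp'p.dvd_of_dvd_pow (hp'p.dvd_of_dvd_pow h1))
  subst this
  refine ⟨iterateFrobenius F p' k, fun x => iterateFrobenius_def _ _ _, fun x => ?_⟩
  rw [iterateFrobenius_def, iterateFrobenius_def, ← pow_mul, ← sq, ← hF, FiniteField.pow_card]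

/-- all facts on the quadratic extension -/
theorem quad_facts (q : ℕ) (hq : 1 < q) (hF : Fintype.card F = q ^ 2) (φ : F →+* F)
    (hφ : ∀ x, φ x = x ^ q) (hφφ : ∀ x, φ (φ x) = x) :
    (Nat.card (φ.eqLocusField (RingHom.id F)) = q) ∧
    (∀ z, φ z = z → ∃ y, φ y + y = z) ∧
    (∀ z, φ z = - z → cnt (fun y => φ y - y) z = q) := by
  let ψ : F →+ F := φ.toAddMonoidHom - AddMonoidHom.id F
  let τ : F →+ F := φ.toAddMonoidHom + AddMonoidHom.id F
  have hψ : ∀ x, ψ x = φ x - x := fun x => rfl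
  have hτ : ∀ x, τ x = φ x + x := fun x => rfl
  have h1 := quad_cards q hq hF ψ τ (fun x => by rw [hψ, hτ, map_add, hφφ]; ring) (-1) 1
    (fun x => by rw [hψ, hφ]; ring) (fun x => by rw [hτ, hφ]; ring)
  have h2 := quad_cards q hq hF τ ψ (fun x => by rw [hψ, hτ, map_sub, hφφ]; ring) 1 (-1)
    (fun x => by rw [hτ, hφ]; ring) (fun x => by rw [hψ, hφ]; ring)
  have hK : ∀ x, x ∈ ψ.ker ↔ φ x = x := by
    intro x; rw [AddMonoidHom.mem_ker, hψ, sub_eq_zero]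
  have hM : ∀ x, x ∈ τ.ker ↔ φ x = -x := by
    intro x; rw [AddMonoidHom.mem_ker, hτ, ← eq_neg_iff_add_eq_zero]
  refine ⟨?_, ?_, ?_⟩
  · rw [← h1.1]
    apply Nat.card_congr
    exact Equiv.subtypeEquivRight (fun x => by rw [hK]; rfl)
  · intro z hz
    have : z ∈ τ.range := by rw [h1.2, hK]; exact hz
    exact this
  · intro z hz
    have : z ∈ ψ.range := by rw [h2.2, hM]; exact hz
    obtain ⟨y0, hy0⟩ := this
    rw [cnt_ncard, ← h1.1]
    have : {y | φ y - y = z} = (fun y => y + y0) '' (ψ.ker : Set F) := by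
      ext y
      simp only [Set.mem_ofPred_eq, Set.mem_image, SetLike.mem_coe, AddMonoidHom.mem_ker]
      constructor
      · intro h
        refine ⟨y - y0, ?_, by ring⟩
        rw [map_sub, hy0, hψ, h, sub_self]
      · rintro ⟨w, hw, rfl⟩
        rw [← hψ, map_add, hw, hy0, zero_add]
    rw [this, Set.ncard_image_of_injective _ (add_left_injective y0)]
    rfl

theorem hyp_count (q : ℕ) (hq : 1 < q) (hF : Fintype.card F = q ^ 2) (h2 : (2 : F) ≠ 0)
    (φ : F →+* F) (hφ : ∀ x, φ x = x ^ q) (hφφ : ∀ x, φ (φ x) = x)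
    (m : ℕ) (hm : Even m ∨ q % 4 = 1) (ε : F) (hε : ε ≠ 0) (hφε : φ ε = -ε)
    (g : Fin (2 * m) → F) (d : F) :
    let N := cnt (fun z : Fin (2 * m) → F =>
      ∑ i, (ε * (φ (z i) + z i) ^ 2 + (φ (g i * z i) - g i * z i))) (φ d - d)
    q * N = q ^ (4 * m) ∨ q * N = q ^ (4 * m) - q ^ (3 * m) ∨
      q * N = q ^ (4 * m) - q ^ (3 * m) + q ^ (3 * m + 1) := by
  classical
  intro N
  obtain ⟨hcard, hsurj, -⟩ := quad_facts q hq hF φ hφ hφφ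
  let K := φ.eqLocusField (RingHom.id F)
  let : Fintype K := Fintype.ofFinite K
  have hcK : Fintype.card K = q := by rw [← hcard, Nat.card_eq_fintype_card]
  have hmem : ∀ x, x ∈ K ↔ φ x = x := fun x => Iff.rfl
  let T : F →ₗ[K] K :=
    { toFun := fun x => ⟨φ x + x, by rw [hmem, map_add, hφφ, add_comm]⟩
      map_add' := fun x y => by
        apply Subtype.ext
        simp only [map_add, Subfield.coe_add]
        ring
      map_smul' := fun k x => by
        apply Subtype.ext
        have hk := (hmem _).1 k.2
        simp only [Subfield.smul_def, smul_eq_mul, map_mul, RingHom.id_apply, Subfield.coe_mul, hk]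
        ring }
  have hTv : ∀ x, ((T x : K) : F) = φ x + x := fun x => rfl
  have hT : Function.Surjective T := by
    intro k
    obtain ⟨y, hy⟩ := hsurj k.1 ((hmem _).1 k.2)
    exact ⟨y, Subtype.ext hy⟩
  have hδ : (φ d - d) / ε ∈ K := by
    rw [hmem, map_div₀, map_sub, hφφ, hφε]
    field_simp
    ring
  have h2' : (2 : K) ≠ 0 := by
    intro h
    exact h2 (congrArg Subtype.val h)
  have := core h2' (by rw [hF, hcK]) T hT m (by rw [hcK]; exact hm)
    (fun i => T ∘ₗ LinearMap.mulLeft K (g i / ε)) ⟨(φ d - d) / ε, hδ⟩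
  simp only [hcK] at this
  convert this using 3 <;>
  · congr 1
    apply cnt_congr
    intro z
    rw [← Subtype.coe_inj, eq_div_iff hε, AddSubmonoidClass.coe_finsetSum, Finset.sum_mul]
    apply Eq.congr_left
    refine Finset.sum_congr rfl fun i _ => ?_
    simp only [LinearMap.comp_apply, LinearMap.mulLeft_apply, AddSubgroupClass.coe_sub, SubmonoidClass.coe_pow,
      hTv, map_mul, map_div₀, hφε]
    field_simp
    ring

open Classical in
theorem cnt_prod {X Y Z : Type*} [Fintype X] [Fintype Y] (P : X → Prop) (f : Y → Z) (G : X → Z)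
    (c : ℤ) (h : ∀ x, cnt f (G x) = c) :
    ((({p : X × Y | P p.1 ∧ f p.2 = G p.1} : Set (X × Y)).ncard : ℕ) : ℤ)
      = c * ({x | P x} : Set X).ncard := by
  have e1 := cnt_ncard (fun p : X × Y => P p.1 ∧ f p.2 = G p.1) True
  have e2 := cnt_ncard P True
  simp only [eq_iff_iff, iff_true] at e1 e2
  rw [← e1, ← e2]
  unfold cnt at *
  rw [Fintype.sum_prod_type, Finset.mul_sum]
  refine Finset.sum_congr rfl fun x _ => ?_
  rw [← h x]
  by_cases hP : P x <;> simp [hP]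


theorem exists_t (q : ℕ) (h2 : (2 : F) ≠ 0)
    (φ : F →+* F) (hφ : ∀ x, φ x = x ^ q) (hφφ : ∀ x, φ (φ x) = x) (a b : F) (ha : a ≠ 0)
    (hb : b ^ q ≠ b) (hab : 4 * a ^ (q + 1) + (b ^ q - b) ^ 2 = 0) :
    ∃ t ε : F, t ≠ 0 ∧ ε ≠ 0 ∧ φ ε = -ε ∧
      ∀ x, (b ^ q - b) * x ^ (q + 1) - a ^ q * x ^ (2 * q) + a * x ^ 2
        = ε * (φ (t * x) + t * x) ^ 2 := by
  rw [← hφ] at hb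
  rw [pow_succ, ← hφ, ← hφ] at hab
  set β := φ b - b with hβ
  have hβ0 : β ≠ 0 := sub_ne_zero.2 hb
  have hφβ : φ β = -β := by rw [hβ, map_sub, hφφ]; ring
  have hφa : φ a ≠ 0 := by simpa using ha
  set s := β / (2 * a) with hs
  have hs2 : 2 * a * s = β := by rw [hs]; field_simp
  have has : a * s ^ 2 = - φ a := by
    have h4 : (4 : F) * a ≠ 0 := by
      have : (4 : F) * a = 2 * (2 * a) := by ring
      rw [this]; exact mul_ne_zero h2 (mul_ne_zero h2 ha)
    apply mul_left_cancel₀ h4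
    linear_combination (2 * a * s + β) * hs2 + hab
  have hs0 : s ≠ 0 := by rw [hs]; exact div_ne_zero hβ0 (mul_ne_zero h2 ha)
  have hss : φ s * s = 1 := by
    have h1 := congrArg φ hs2
    rw [map_mul, map_mul, hφβ, map_ofNat] at h1
    have : 2 * φ a ≠ 0 := mul_ne_zero h2 hφa
    apply mul_left_cancel₀ this
    linear_combination s * h1 + s * hs2 - 2 * has
  obtain ⟨t, ht, hst⟩ : ∃ t : F, t ≠ 0 ∧ φ t = s * t := by
    by_cases h : s = -1
    · exact ⟨β, hβ0, by rw [hφβ, h]; ring⟩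
    · refine ⟨1 + φ s, ?_, ?_⟩
      · intro h0
        apply h
        linear_combination s * h0 - hss
      · rw [map_add, map_one, hφφ]
        linear_combination -hss
  refine ⟨t, a / t ^ 2, ht, div_ne_zero ha (pow_ne_zero 2 ht), ?_, ?_⟩
  · rw [map_div₀, map_pow, hst]
    field_simp
    linear_combination has
  · intro x
    rw [map_mul, hst, pow_succ, mul_comm 2 q, pow_mul, ← hφ a, ← hφ x, ← hφ b]
    field_simp
    linear_combination - x * φ x * hs2 - (φ x) ^ 2 * has

end

theorem statement3 (q r : ℕ) (hq : IsPrimePow q) (hqodd : Odd q)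
    (hr : 3 ≤ r) (hrodd : Odd r) (hmod : r % 4 = 1 ∨ q % 4 = 1)
    {F : Type*} [Field F] [Fintype F] (hF : Fintype.card F = q ^ 2)
    (a b : F) (ha : a ≠ 0) (hb : b ^ q ≠ b)
    (hab : 4 * a ^ (q + 1) + (b ^ q - b) ^ 2 = 0) :
    (BSet q r a b).ncard = q ^ (2 * r - 1) ∧
    ∀ (c : Fin (r - 1) → F) (c0 d : F), ¬(c = 0 ∧ c0 = 0) →
      (({x : (Fin (r - 1) → F) × F | (∑ i, c i * x.1 i) + c0 * x.2 = d}
          ∩ BSet q r a b)).ncard ∈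
        ({q ^ (2 * r - 3) - q ^ ((3 * r - 5) / 2), q ^ (2 * r - 3),
          q ^ (2 * r - 3) - q ^ ((3 * r - 5) / 2) + q ^ (3 * (r - 1) / 2)} : Set ℕ) := by
  classical
  have hq1 : 1 < q := hq.one_lt
  have h2 : (2 : F) ≠ 0 := by
    apply Ring.two_ne_zero
    intro h
    have := FiniteField.even_card_iff_char_two.1 h
    rw [hF] at this
    have h3 : Odd (q ^ 2) := hqodd.pow
    rw [Nat.odd_iff] at h3
    omega
  obtain ⟨φ, hφ, hφφ⟩ := quad_frob q hq hF
  obtain ⟨t, ε, ht, hε, hφε, hg⟩ := exists_t q h2 φ hφ hφφ a b ha hb hab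
  obtain ⟨-, -, hfib⟩ := quad_facts q hq1 hF φ hφ hφφ
  obtain ⟨m, hm⟩ := hrodd
  obtain ⟨k, rfl⟩ : ∃ k, m = k + 1 := ⟨m - 1, by omega⟩
  have hB : BSet q r a b = {x : (Fin (r - 1) → F) × F |
      φ x.2 - x.2 = ε * ∑ i, (φ (t * x.1 i) + t * x.1 i) ^ 2} := by
    ext x
    simp only [BSet, Set.mem_ofPred_eq]
    have h1 : ε * ∑ i, (φ (t * x.1 i) + t * x.1 i) ^ 2 = (b ^ q - b) * ∑ i, x.1 i ^ (q + 1)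
        - a ^ q * (∑ i, x.1 i ^ (2 * q)) + a * (∑ i, x.1 i ^ 2) := by
      rw [Finset.mul_sum, ← Finset.sum_congr rfl (fun i _ => hg (x.1 i)), Finset.sum_add_distrib,
        Finset.sum_sub_distrib, ← Finset.mul_sum, ← Finset.mul_sum, ← Finset.mul_sum]
    rw [h1, hφ]
    constructor <;> intro h <;> linear_combination h
  rw [hB]
  have e1 : 2 * r - 1 = 4 * (k + 1) + 1 := by omega
  have e2 : 2 * r - 3 = 4 * k + 3 := by omega
  have e3 : (3 * r - 5) / 2 = 3 * k + 2 := by omega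
  have e4 : 3 * (r - 1) / 2 = 3 * k + 3 := by omega
  have e5 : r - 1 = 2 * (k + 1) := by omega
  have hmod' : Even (k + 1) ∨ q % 4 = 1 := by
    rcases hmod with h | h
    · left; rw [Nat.even_iff]; omega
    · exact Or.inr h
  rw [e1, e2, e3, e4]
  clear hB e1 e2 e3 e4 hmod
  generalize r - 1 = n at *
  subst e5
  have hq0 : (q : ℤ) ≠ 0 := by positivity
  have hGf : ∀ x : Fin (2 * (k + 1)) → F,
      cnt (fun y => φ y - y) (ε * ∑ i, (φ (t * x i) + t * x i) ^ 2) = q := by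
    intro x
    apply hfib
    rw [map_mul, hφε, map_sum, neg_mul]
    congr 2
    refine Finset.sum_congr rfl fun i _ => ?_
    rw [map_pow, map_add, hφφ, add_comm]
  refine ⟨?_, ?_⟩
  · have := cnt_prod (fun _ : Fin (2 * (k + 1)) → F => True) (fun y => φ y - y) _ _ hGf
    simp only [true_and] at this
    zify
    rw [this]
    simp only [Set.ofPred_true, Set.ncard_univ, Nat.card_eq_fintype_card, Fintype.card_pi, hF,
      Finset.prod_const, Finset.card_univ, Fintype.card_fin]
    push_cast
    ring
  intro c c0 d hc
  by_cases hc0 : c0 = 0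
  · right; left
    subst hc0
    have hc' : c ≠ 0 := fun h => hc ⟨h, rfl⟩
    obtain ⟨i, hi⟩ := Function.ne_iff.1 hc'
    have h1 := cnt_prod (fun x : Fin (2 * (k + 1)) → F => ∑ i, c i * x i = d)
      (fun y => φ y - y) _ _ hGf
    have h3 := cnt_shift (fun x : Fin (2 * (k + 1)) → F => ∑ i, c i * x i) (fun l =>
      ⟨Equiv.addRight (Pi.single i (l / c i)), fun x => by
        simp only [Equiv.coe_addRight, Pi.add_apply, mul_add, Finset.sum_add_distrib]
        congr 1
        rw [Finset.sum_eq_single i]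
        · have : c i ≠ 0 := hi
          simp only [Pi.single_eq_same]; field_simp
        · intro j _ hj; simp [hj]
        · simp⟩) d
    rw [cnt_ncard] at h3
    simp only [Fintype.card_pi, hF, Finset.prod_const, Finset.card_univ, Fintype.card_fin] at h3
    simp only [zero_mul, add_zero]
    change Set.ncard {p : (Fin (2 * (k + 1)) → F) × F | (∑ i, c i * p.1 i = d) ∧
      φ p.2 - p.2 = ε * ∑ i, (φ (t * p.1 i) + t * p.1 i) ^ 2} = _
    zify
    rw [h1]
    push_cast at h3
    apply mul_left_cancel₀ hq0
    calc _ = (q : ℤ) ^ 2 * _ := by rw [sq, mul_assoc]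
      _ = _ := h3
      _ = _ := by ring
  · have h1 : ({x : (Fin (2 * (k + 1)) → F) × F | (∑ i, c i * x.1 i) + c0 * x.2 = d} ∩
        {x | φ x.2 - x.2 = ε * ∑ i, (φ (t * x.1 i) + t * x.1 i) ^ 2}) =
        (fun x : Fin (2 * (k + 1)) → F => (x, (d - ∑ i, c i * x i) / c0)) ''
        {x | φ ((d - ∑ i, c i * x i) / c0) - ((d - ∑ i, c i * x i) / c0) =
          ε * ∑ i, (φ (t * x i) + t * x i) ^ 2} := by
      ext ⟨x, y⟩
      simp only [Set.mem_inter_iff, Set.mem_ofPred_eq, Set.mem_image, Prod.mk.injEq]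
      have hy : (∑ i, c i * x i) + c0 * y = d ↔ (d - ∑ i, c i * x i) / c0 = y := by
        rw [div_eq_iff hc0]
        constructor <;> intro h <;> linear_combination -h
      rw [hy]
      constructor
      · rintro ⟨h, h'⟩
        refine ⟨x, ?_, rfl, h⟩
        rw [h]; exact h'
      · rintro ⟨x', h, rfl, rfl⟩
        exact ⟨rfl, h⟩
    rw [h1, Set.ncard_image_of_injective _ (fun x y h => congrArg Prod.fst h)]
    have h3 := hyp_count q hq1 hF h2 φ hφ hφφ (k + 1) hmod' ε hε hφε
      (fun i => c i / (c0 * t)) (d / c0)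
    rw [← cnt_comp (Equiv.piCongrRight (fun _ : Fin (2 * (k + 1)) => Equiv.mulLeft₀ t ht)),
      cnt_ncard] at h3
    have h4 : {x : Fin (2 * (k + 1)) → F |
        φ ((d - ∑ i, c i * x i) / c0) - ((d - ∑ i, c i * x i) / c0) =
          ε * ∑ i, (φ (t * x i) + t * x i) ^ 2} =
        {x | ∑ i, (ε * (φ ((Equiv.piCongrRight (fun _ => Equiv.mulLeft₀ t ht)) x i) +
          (Equiv.piCongrRight (fun _ => Equiv.mulLeft₀ t ht)) x i) ^ 2 +
          (φ (c i / (c0 * t) * (Equiv.piCongrRight (fun _ => Equiv.mulLeft₀ t ht)) x i) -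
          c i / (c0 * t) * (Equiv.piCongrRight (fun _ => Equiv.mulLeft₀ t ht)) x i)) =
          φ (d / c0) - d / c0} := by
      ext x
      simp only [Set.mem_ofPred_eq, Equiv.piCongrRight_apply, Pi.map_apply, Equiv.mulLeft₀_apply]
      have h5 : ∀ i, c i / (c0 * t) * (t * x i) = c i * x i / c0 := by
        intro i; field_simp
      simp only [h5]
      rw [Finset.sum_add_distrib, Finset.sum_sub_distrib, ← Finset.mul_sum, ← map_sum,
        ← Finset.sum_div, sub_div, map_sub]
      constructor <;> intro h <;> linear_combination -h
    rw [← h4] at h3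
    generalize Set.ncard _ = N at h3
    have hle : q ^ (3 * k + 2) ≤ q ^ (4 * k + 3) := Nat.pow_le_pow_right hq1.le (by omega)
    simp only [Set.mem_insert_iff, Set.mem_singleton_iff]
    zify [hle]
    rcases h3 with h | h | h
    · right; left
      apply mul_left_cancel₀ hq0
      rw [h]; ring
    · left
      apply mul_left_cancel₀ hq0
      rw [h]; ring
    · right; right
      apply mul_left_cancel₀ hq0
      rw [h]; ring
end

section
/- Let q be an odd prime power, r > 2 an integer, a ∈ F\{0} and b ∈ F with b^q ≠ b, where F = GF(q²), and suppose 4a^{q+1} + (b^q − b)² = 0. Let t be the minimum of |π ∩ B(a,b)| over all affine hyperplanes π of F^r. Then t ≥ 1 and for every point P ∈ B(a,b) there exists an affine hyperplane π of F^r with P ∈ π and |π ∩ B(a,b)| = t; that is, B(a,b) is a minimal t-fold blocking set with respect to the hyperplanes of AG(r,q²). -/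
open Finset

/-- The minimum, over all affine hyperplanes `π` of `F^r`, of `|π ∩ B(a,b)|`. -/
noncomputable def tmin (q r : ℕ) {F : Type*} [Field F] (a b : F) : ℕ :=
  sInf {n : ℕ | ∃ (c : Fin (r - 1) → F) (c0 d : F), ¬(c = 0 ∧ c0 = 0) ∧
    n = ({x : (Fin (r - 1) → F) × F | (∑ i, c i * x.1 i) + c0 * x.2 = d}
          ∩ BSet q r a b).ncard}

namespace BAux

lemma fib {X Y : Type*} [Fintype X] (g : X → Y) (S : Finset Y) (hS : ∀ x, g x ∈ S)
    (y0 : Y) (h : ∀ y ∈ S, ∃ e : X → X, Function.Injective e ∧ ∀ x, g x = y → g (e x) = y0) :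
    Fintype.card X ≤ S.card * {x | g x = y0}.ncard := by
  classical
  have h1 := Finset.card_eq_sum_card_fiberwise (s := (Finset.univ : Finset X)) (t := S) (f := g)
    (fun x _ => hS x)
  rw [Finset.card_univ] at h1
  rw [h1, ← smul_eq_mul]
  apply Finset.sum_le_card_nsmul
  intro y hy
  obtain ⟨e, he, hg⟩ := h y hy
  rw [← Set.ncard_coe_finset]
  refine Set.ncard_le_ncard_of_injOn e ?_ he.injOn (Set.toFinite _)
  intro x hx
  simp at hx
  exact hg x hx

lemma two_squares {K : Type*} [Field K] [Fintype K] (h2 : (2 : K) ≠ 0) (k : K) :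
    ∃ x y : K, x ^ 2 + y ^ 2 = k := by
  have hc : ringChar K ≠ 2 := by
    intro h
    apply h2
    have := ringChar.Nat.cast_ringChar (R := K)
    rw [h] at this
    exact_mod_cast this
  obtain ⟨x, y, h⟩ := FiniteField.exists_root_sum_quadratic (R := K)
    (f := Polynomial.X ^ 2) (g := Polynomial.X ^ 2 - Polynomial.C k)
    (Polynomial.degree_X_pow 2) (Polynomial.degree_X_pow_sub_C (by decide) _)
    (FiniteField.odd_card_of_char_ne_two hc)
  refine ⟨x, y, ?_⟩
  simp at h
  linear_combination h

set_option linter.unusedSectionVars false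

section
variable {F : Type*} [Field F] [Fintype F] (φ : F →+* F) (a g : F) {n : ℕ}

def L (x : F) : F := φ x - g * x

def Q (x : Fin n → F) : F := φ a * ∑ i, L φ g (x i) ^ 2

/-- counts of points over a value -/
noncomputable def M (n : ℕ) (w : F) : ℕ := {x : Fin n → F | Q φ a g x = w}.ncard

/-- counts of points on a hyperplane -/
def H (c : Fin n → F) (d : F) : Set (Fin n → F) :=
  {x | Q φ a g x + (φ (∑ i, c i * x i + d) - (∑ i, c i * x i + d)) = 0}

lemma φL (hφ : ∀ x, φ (φ x) = x) (hg : g * φ g = 1)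
    (x : F) : φ (L φ g x) = - φ g * L φ g x := by
  simp only [L, map_sub, map_mul, hφ]
  linear_combination (-x) * hg

lemma φQ (hφ : ∀ x, φ (φ x) = x) (hg : g * φ g = 1) (hag : a * φ g = - (φ a * g))
    (x : Fin n → F) : φ (Q φ a g x) = - Q φ a g x := by
  simp only [Q, map_sum, map_mul, hφ, map_pow, φL φ g hφ hg, mul_pow, ← Finset.mul_sum]
  generalize ∑ i, L φ g (x i) ^ 2 = s
  linear_combination (φ g * s) * hag - φ a * s * hg

lemma L_add (x y : F) : L φ g (x + y) = L φ g x + L φ g y := by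
  simp only [L, map_add]; ring

lemma L_sub (x y : F) : L φ g (x - y) = L φ g x - L φ g y := by
  simp only [L, map_sub]; ring

lemma mem_H_iff (c v : Fin n → F) (d : F)
    (hc : ∀ i, φ (c i) = -2 * φ a * L φ g (v i)) (hc2 : ∀ i, c i = φ (c i) * g)
    (x : Fin n → F) : x ∈ H φ a g c d ↔ Q φ a g (x - v) = Q φ a g v - (φ d - d) := by
  have h1 : φ (∑ i, c i * x i) - ∑ i, c i * x i
      = -2 * φ a * ∑ i, L φ g (v i) * L φ g (x i) := by
    rw [map_sum, ← Finset.sum_sub_distrib, Finset.mul_sum]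
    refine Finset.sum_congr rfl fun i _ => ?_
    rw [map_mul, ← mul_assoc, ← hc]
    have := hc2 i
    simp only [L]
    linear_combination (-x i) * this
  have h3 : Q φ a g (x - v) = Q φ a g x + Q φ a g v
      - 2 * φ a * ∑ i, L φ g (v i) * L φ g (x i) := by
    simp only [Q, Pi.sub_apply, L_sub, Finset.mul_sum, ← Finset.sum_add_distrib,
      ← Finset.sum_sub_distrib]
    refine Finset.sum_congr rfl fun i _ => ?_
    ring
  change _ + _ = _ ↔ _
  rw [map_add, h3]
  constructor <;> intro h
  · linear_combination h - h1
  · linear_combination h + h1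

/-- the completed-square count -/
lemma ncard_square (c v : Fin n → F) (d : F)
    (hc : ∀ i, φ (c i) = -2 * φ a * L φ g (v i)) (hc2 : ∀ i, c i = φ (c i) * g) :
    (H φ a g c d).ncard = M φ a g n (Q φ a g v - (φ d - d)) := by
  unfold M
  rw [← Set.ncard_image_of_injective (H φ a g c d) (f := fun x => x - v) sub_left_injective]
  congr 1
  ext y
  constructor
  · rintro ⟨x, hx, rfl⟩
    exact (mem_H_iff φ a g c v d hc hc2 x).1 hx
  · intro hy
    refine ⟨y + v, (mem_H_iff φ a g c v d hc hc2 _).2 ?_, by simp⟩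
    simpa using hy

open Classical in
/-- the skew elements -/
noncomputable def S : Finset F := Finset.univ.filter fun w => φ w = - w

lemma mem_S {w : F} : w ∈ S φ ↔ φ w = -w := by simp [S]

lemma M_le (hφ : ∀ x, φ (φ x) = x) (hg : g * φ g = 1) (hag : a * φ g = - (φ a * g))
    (w0 : F) (hmin : ∀ w ∈ S φ, M φ a g n w0 ≤ M φ a g n w) :
    (S φ).card * M φ a g n w0 ≤ Fintype.card (Fin n → F) := by
  classical
  have h1 := Finset.card_eq_sum_card_fiberwise (s := (Finset.univ : Finset (Fin n → F)))
    (t := S φ) (f := Q φ a g) (fun x _ => (mem_S φ).2 (φQ φ a g hφ hg hag x))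
  rw [Finset.card_univ] at h1
  rw [h1, ← smul_eq_mul]
  apply Finset.card_nsmul_le_sum
  intro y hy
  refine (hmin y hy).trans (le_of_eq ?_)
  rw [M, ← Set.ncard_coe_finset]
  congr 1
  ext x
  simp

lemma exists_ker (hg : g * φ g = 1)
    (b : F) (hb : φ b ≠ b) (hφ : ∀ x, φ (φ x) = x) :
    ∃ u, u ≠ 0 ∧ L φ g u = 0 := by
  have key : ∀ z, L φ g (z + φ g * φ z) = 0 := by
    intro z
    simp only [L, map_add, map_mul, hφ]
    linear_combination (-φ z) * hg
  by_cases h : 1 + φ g * φ 1 = 0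
  · refine ⟨_, fun h' => hb ?_, key b⟩
    rw [map_one] at h
    linear_combination φ b * h - h'
  · exact ⟨_, h, key 1⟩

lemma exists_im (b : F) (hb : φ b ≠ b) : ∃ u, L φ g u ≠ 0 := by
  by_contra! h
  apply hb
  have h1 := h 1
  have h3 := h b
  simp only [L, map_one] at h1 h3
  linear_combination h3 - b * h1

lemma L_smul {k : F} (hk : φ k = k) (x : F) : L φ g (k * x) = k * L φ g x := by
  simp only [L, map_mul, hk]; ring

lemma Q_surj (hφ : ∀ x, φ (φ x) = x) (hg : g * φ g = 1) (hag : a * φ g = - (φ a * g)) (ha : a ≠ 0) (h2 : (2 : F) ≠ 0)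
    (b : F) (hb : φ b ≠ b) (hn : 2 ≤ n) (w : F) (hw : φ w = -w) :
    ∃ x : Fin n → F, Q φ a g x = w := by
  classical
  obtain ⟨ξ, hξ⟩ := exists_im φ g b hb
  set m := L φ g ξ with hm
  have hfa : φ a ≠ 0 := by simpa using ha
  have hsk : φ (φ a * m ^ 2) = -(φ a * m ^ 2) := by
    have := φQ φ a g hφ hg hag (fun _ : Fin 1 => ξ)
    simpa [Q] using this
  have hne : φ a * m ^ 2 ≠ 0 := by positivity
  let K := φ.eqLocusField (RingHom.id F)
  have hκ : w / (φ a * m ^ 2) ∈ K := by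
    change φ _ = _
    rw [map_div₀, hsk, hw, neg_div_neg_eq]
    rfl
  have : Fintype K := Fintype.ofFinite K
  obtain ⟨s, t, hst⟩ := two_squares (K := K)
    (fun h => h2 (congrArg (Subtype.val) h)) ⟨_, hκ⟩
  have hst' : (s : F) ^ 2 + (t : F) ^ 2 = w / (φ a * m ^ 2) := by
    exact congrArg (Subtype.val) hst
  have hs : φ s = s := s.2
  have ht : φ t = t := t.2
  obtain ⟨k, rfl⟩ := Nat.exists_eq_add_of_le' hn
  refine ⟨Fin.cons (s * ξ) (Fin.cons (t * ξ) 0), ?_⟩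
  have h0 : L φ g 0 = 0 := by simp [L]
  simp only [Q, Fin.sum_univ_succ, Fin.cons_zero, Fin.cons_succ, L_smul φ g hs, L_smul φ g ht,
    Pi.zero_apply, h0, ← hm]
  rw [eq_div_iff hne] at hst'
  simp
  linear_combination hst'

lemma H_ge (hφ : ∀ x, φ (φ x) = x) (hg : g * φ g = 1) (hag : a * φ g = - (φ a * g)) (ha : a ≠ 0) (h2 : (2 : F) ≠ 0)
    (b : F) (hb : φ b ≠ b) (w0 : F) (hmin : ∀ w ∈ S φ, M φ a g n w0 ≤ M φ a g n w)
    (c : Fin n → F) (d : F) : M φ a g n w0 ≤ (H φ a g c d).ncard := by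
  classical
  have hfa : φ a ≠ 0 := by simpa using ha
  have hT : ∀ z, φ (φ z - z) = -(φ z - z) := fun z => by rw [map_sub, hφ]; ring
  by_cases hc : ∀ i, c i = φ (c i) * g
  · have h4 : (4 : F) ≠ 0 := by
      have : (4 : F) = 2 * 2 := by norm_num
      rw [this]; exact mul_ne_zero h2 h2
    rw [ncard_square φ a g c (fun i => φ (c i) * φ g / (4 * φ a)) d ?_ hc]
    · apply hmin
      rw [mem_S, map_sub, φQ φ a g hφ hg hag, hT]; ring
    · intro i
      have e1 := hc i
      have e2 : φ (4 : F) = 4 := map_ofNat φ 4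
      simp only [L, map_mul, map_div₀, hφ, e2]
      have e3 : φ a * g ^ 2 = -a := by linear_combination g * hag - a * hg
      have e4 : c i * g / (4 * a) = - φ (c i) / (4 * φ a) := by
        rw [div_eq_div_iff (mul_ne_zero h4 ha) (mul_ne_zero h4 hfa)]
        linear_combination 4 * g * φ a * e1 + 4 * φ (c i) * e3
      rw [e4]
      field_simp
      linear_combination (-2) * φ (c i) * hg
  · push Not at hc
    obtain ⟨i0, hi0⟩ := hc
    obtain ⟨u, hu, hLu⟩ := exists_ker φ g hg b hb hφ
    have hpos : 0 < (S φ).card := Finset.card_pos.2 ⟨0, by simp [mem_S]⟩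
    refine Nat.le_of_mul_le_mul_left ((M_le φ a g hφ hg hag w0 hmin).trans ?_) hpos
    refine fib (fun x : Fin n → F =>
      Q φ a g x + (φ (∑ i, c i * x i + d) - (∑ i, c i * x i + d))) (S φ) ?_ 0 ?_
    · intro x
      rw [mem_S, map_add, φQ φ a g hφ hg hag, hT]; ring
    · intro y hy
      rw [mem_S] at hy
      set τ := φ (c i0 * u) - c i0 * u with hτ
      have hu' : φ u = g * u := sub_eq_zero.1 hLu
      have hτ0 : τ ≠ 0 := by
        have : τ = (φ (c i0) * g - c i0) * u := by
          rw [hτ, map_mul, hu']; ring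
        rw [this]
        exact mul_ne_zero (sub_ne_zero.2 hi0.symm) hu
      have hk : φ (-y / τ) = -y / τ := by
        rw [map_div₀, map_neg, hy, hτ, hT, neg_div_neg_eq]
      refine ⟨fun x => x + Pi.single i0 (-y / τ * u), add_left_injective _, ?_⟩
      intro x hx
      have hQ : Q φ a g (x + Pi.single i0 (-y / τ * u)) = Q φ a g x := by
        simp only [Q, Pi.add_apply, L_add]
        congr 1
        refine Finset.sum_congr rfl fun i _ => ?_
        by_cases hi : i = i0
        · subst hi
          simp [L_smul φ g hk, hLu]
        · simp [hi, L]
      have hsum : ∑ i, c i * (x + Pi.single i0 (-y / τ * u) : Fin n → F) i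
          = ∑ i, c i * x i + -y / τ * (c i0 * u) := by
        simp only [Pi.add_apply, mul_add, Finset.sum_add_distrib]
        congr 1
        simp [Pi.single_apply]
        ring
      simp only [hQ, hsum]
      simp only [map_add] at hx ⊢
      rw [map_mul, hk]
      have hyt : -y / τ * τ = -y := div_mul_cancel₀ _ hτ0
      rw [hτ] at hyt ⊢
      linear_combination hx + hyt

lemma vert_ge (hφ : ∀ x, φ (φ x) = x) (hg : g * φ g = 1) (hag : a * φ g = - (φ a * g)) (h2 : (2 : F) ≠ 0)
    (w0 : F) (hmin : ∀ w ∈ S φ, M φ a g n w0 ≤ M φ a g n w)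
    (c : Fin n → F) (hc : c ≠ 0) (d : F) : M φ a g n w0 ≤
      {x : (Fin n → F) × F | ∑ i, c i * x.1 i = d ∧ Q φ a g x.1 + (φ x.2 - x.2) = 0}.ncard := by
  classical
  obtain ⟨i0, hi0⟩ := Function.ne_iff.1 hc
  have hT : ∀ z, φ (φ z - z) = -(φ z - z) := fun z => by rw [map_sub, hφ]; ring
  have hpos : 0 < (S φ).card := Finset.card_pos.2 ⟨0, by simp [mem_S]⟩
  have hF : 0 < Fintype.card F := Fintype.card_pos
  have h1 := fib (fun x : (Fin n → F) × F => (∑ i, c i * x.1 i, Q φ a g x.1 + (φ x.2 - x.2)))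
    (Finset.univ ×ˢ S φ) (fun x => by
      simp only [Finset.mem_product, Finset.mem_univ, true_and]
      rw [mem_S, map_add, φQ φ a g hφ hg hag, hT]; ring) (d, 0) (by
      rintro ⟨d', w⟩ hy
      simp only [Finset.mem_product, Finset.mem_univ, true_and, mem_S] at hy
      set v : Fin n → F := Pi.single i0 ((d - d') / c i0) with hv
      refine ⟨fun x => (x.1 + v, x.2 + -(Q φ a g x.1 - Q φ a g (x.1 + v) - w) / 2), ?_, ?_⟩
      · rintro ⟨x, z⟩ ⟨x', z'⟩ h
        simp only [Prod.mk.injEq] at h ⊢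
        obtain ⟨h3, h4⟩ := h
        have : x = x' := add_left_injective _ h3
        subst this
        exact ⟨rfl, add_left_injective _ h4⟩
      · rintro ⟨x, z⟩ h
        simp only [Prod.mk.injEq] at h ⊢
        obtain ⟨h3, h4⟩ := h
        constructor
        · simp only [Pi.add_apply, mul_add, Finset.sum_add_distrib, h3]
          have : ∑ i, c i * v i = d - d' := by
            simp only [hv, Pi.single_apply, mul_ite, mul_zero, Finset.sum_ite_eq',
              Finset.mem_univ, if_true]
            exact mul_div_cancel₀ _ hi0
          rw [this]; ring
        · have e2 : φ (2 : F) = 2 := map_ofNat φ 2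
          simp only [map_add, map_div₀, map_neg, map_sub, φQ φ a g hφ hg hag, hy, e2]
          field_simp
          linear_combination 2 * h4)
  rw [Fintype.card_prod, Finset.card_product, Finset.card_univ] at h1
  have h3 := M_le φ a g hφ hg hag w0 hmin
  have h4 : {x : (Fin n → F) × F | (∑ i, c i * x.1 i, Q φ a g x.1 + (φ x.2 - x.2)) = (d, 0)}
    = {x : (Fin n → F) × F | ∑ i, c i * x.1 i = d ∧ Q φ a g x.1 + (φ x.2 - x.2) = 0} := by
    ext x; simp
  rw [h4] at h1
  have hpos2 : 0 < Fintype.card F * (S φ).card := by positivity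
  refine Nat.le_of_mul_le_mul_left ?_ hpos2
  refine le_trans ?_ h1
  rw [mul_assoc, mul_comm (Fintype.card (Fin n → F))]
  exact Nat.mul_le_mul_left _ h3

lemma through (hφ : ∀ x, φ (φ x) = x) (hg : g * φ g = 1) (hag : a * φ g = - (φ a * g))
    (w0 : F) (y0 : Fin n → F) (hy0 : Q φ a g y0 = w0) (p : Fin n → F) (z : F)
    (hp : Q φ a g p + (φ z - z) = 0) :
    ∃ c : Fin n → F, (H φ a g c (z - ∑ i, c i * p i)).ncard = M φ a g n w0 := by
  set v := p - y0 with hv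
  let c : Fin n → F := fun i => -2 * a * φ (L φ g (v i))
  have e2 : φ (2 : F) = 2 := map_ofNat φ 2
  have hc : ∀ i, φ (c i) = -2 * φ a * L φ g (v i) := by
    intro i; simp only [c, map_mul, map_neg, hφ, e2]
  have hc2 : ∀ i, c i = φ (c i) * g := by
    intro i
    rw [hc]
    simp only [c]
    rw [φL φ g hφ hg]
    linear_combination 2 * L φ g (v i) * hag
  refine ⟨c, ?_⟩
  rw [ncard_square φ a g c v _ hc hc2]
  congr 1
  rw [← (mem_H_iff φ a g c v _ hc hc2 p).1, ← hy0]
  · rw [hv]; congr 1; abel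
  · change _ + _ = _
    rw [← hp]
    have : ∑ i, c i * p i + (z - ∑ i, c i * p i) = z := by ring
    rw [this]

end
end BAux

/-- for `q` odd, `r > 2` and `4a^{q+1} + (b^q − b)² = 0`, letting `t` be the
minimum size of the intersection of `B(a,b)` with an affine hyperplane, we have `t ≥ 1`
and every point of `B(a,b)` lies on a hyperplane meeting `B(a,b)` in exactly `t` points;
i.e. `B(a,b)` is a minimal `t`-fold blocking set with respect to hyperplanes. -/
theorem statement6 (q r : ℕ) (hq : IsPrimePow q) (hqodd : Odd q) (hr : 2 < r)
    {F : Type*} [Field F] [Fintype F] (hF : Fintype.card F = q ^ 2)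
    (a b : F) (ha : a ≠ 0) (hb : b ^ q ≠ b)
    (hab : 4 * a ^ (q + 1) + (b ^ q - b) ^ 2 = 0) :
    1 ≤ tmin q r a b ∧
    ∀ P ∈ BSet q r a b, ∃ (c : Fin (r - 1) → F) (c0 d : F), ¬(c = 0 ∧ c0 = 0) ∧
      (∑ i, c i * P.1 i) + c0 * P.2 = d ∧
      ({x : (Fin (r - 1) → F) × F | (∑ i, c i * x.1 i) + c0 * x.2 = d}
          ∩ BSet q r a b).ncard = tmin q r a b := by
  have hn : 2 ≤ r - 1 := by omega
  obtain ⟨φ, hφq⟩ : ∃ φ : F →+* F, ∀ x, φ x = x ^ q := by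
    obtain ⟨p, k, hp, hk, hpk⟩ := hq
    have hp' : p.Prime := hp.nat_prime
    have : Fact p.Prime := ⟨hp'⟩
    have hch : CharP F p := by
      have hc := Nat.cast_card_eq_zero F
      rw [hF, ← hpk] at hc
      push_cast at hc
      have : (p : F) = 0 := by
        by_contra h
        exact pow_ne_zero _ (pow_ne_zero _ h) hc
      have h1 : ringChar F ∣ p := (ringChar.spec F p).1 this
      have h3 : ringChar F ≠ 1 := CharP.ringChar_ne_one
      have h4 := (Nat.dvd_prime hp').1 h1
      have h5 : ringChar F = p := by tauto
      rw [← h5]; infer_instance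
    have : ExpChar F p := ExpChar.prime hp'
    exact ⟨iterateFrobenius F p k, fun x => by rw [iterateFrobenius_def, hpk]⟩
  have hφ : ∀ x, φ (φ x) = x := by
    intro x
    rw [hφq, hφq, ← pow_mul, ← sq, ← hF, FiniteField.pow_card]
  have h2 : (2 : F) ≠ 0 := by
    intro h
    have hodd : Odd (Fintype.card F) := by rw [hF]; exact hqodd.pow
    obtain ⟨m, hm⟩ := hodd
    have hc := Nat.cast_card_eq_zero F
    rw [hm] at hc
    push_cast at hc
    rw [h] at hc
    simp at hc
  have h4 : (4 : F) ≠ 0 := by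
    have : (4 : F) = 2 * 2 := by norm_num
    rw [this]; exact mul_ne_zero h2 h2
  have hfa : φ a ≠ 0 := by simpa using ha
  have e2 : φ (2 : F) = 2 := map_ofNat φ 2
  have hb' : φ b ≠ b := by rwa [hφq]
  have hab' : 4 * (a * φ a) + (φ b - b) ^ 2 = 0 := by
    rw [hφq, hφq, ← hab]; ring
  obtain ⟨g, hgdef⟩ : ∃ g, g = (φ b - b) / (2 * φ a) := ⟨_, rfl⟩
  have hgb : 2 * φ a * g = φ b - b := by rw [hgdef]; field_simp
  have hgb' : 2 * a * φ g = -(φ b - b) := by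
    have := congrArg φ hgb
    simp only [map_mul, map_sub, hφ, e2] at this
    rw [this]; ring
  have hag : a * φ g = -(φ a * g) := by
    apply mul_left_cancel₀ h2
    linear_combination hgb + hgb'
  have hg : g * φ g = 1 := by
    apply mul_left_cancel₀ (mul_ne_zero h4 (mul_ne_zero ha hfa))
    linear_combination (2 * a * φ g) * hgb + (φ b - b) * hgb' - hab'
  have hB : ∀ x : (Fin (r - 1) → F) × F, x ∈ BSet q r a b ↔
      BAux.Q φ a g x.1 + (φ x.2 - x.2) = 0 := by
    intro x
    have hQ : BAux.Q φ a g x.1 = a ^ q * (∑ i, x.1 i ^ (2 * q)) - a * (∑ i, x.1 i ^ 2)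
        - (b ^ q - b) * ∑ i, x.1 i ^ (q + 1) := by
      simp only [BAux.Q, Finset.mul_sum, ← Finset.sum_sub_distrib]
      refine Finset.sum_congr rfl fun i _ => ?_
      have h1 : x.1 i ^ (2 * q) = φ (x.1 i) ^ 2 := by rw [hφq]; ring
      have h3 : x.1 i ^ (q + 1) = φ (x.1 i) * x.1 i := by rw [hφq]; ring
      have e3 : φ a * g ^ 2 = -a := by linear_combination g * hag - a * hg
      rw [h1, h3, ← hφq, ← hφq]
      simp only [BAux.L]
      linear_combination x.1 i ^ 2 * e3 - x.1 i * φ (x.1 i) * hgb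
    change _ = _ ↔ _
    rw [hQ, hφq]
    constructor <;> intro h <;> linear_combination h
  have hnv : ∀ (c : Fin (r - 1) → F) (d : F),
      {x : (Fin (r - 1) → F) × F | x.2 = ∑ i, c i * x.1 i + d ∧ x ∈ BSet q r a b}.ncard
        = (BAux.H φ a g c d).ncard := by
    intro c d
    have hinj : Function.Injective (fun x : Fin (r - 1) → F => (x, ∑ i, c i * x i + d)) :=
      fun x y h => (Prod.mk.inj h).1
    rw [← Set.ncard_image_of_injective _ hinj]
    congr 1
    ext ⟨x, z⟩
    constructor
    · rintro ⟨h1, h3⟩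
      rw [hB] at h3
      simp only at h1 h3
      subst h1
      exact ⟨x, h3, rfl⟩
    · rintro ⟨y, hy, h⟩
      simp only [Prod.mk.injEq] at h
      obtain ⟨rfl, rfl⟩ := h
      exact ⟨rfl, (hB _).2 hy⟩
  obtain ⟨w0, hw0, hmin⟩ := Finset.exists_min_image (BAux.S φ) (BAux.M φ a g (r - 1))
    ⟨0, by simp [BAux.mem_S]⟩
  obtain ⟨y0, hy0⟩ := BAux.Q_surj φ a g hφ hg hag ha h2 b hb' hn w0 ((BAux.mem_S φ).1 hw0)
  have hMpos : 1 ≤ BAux.M φ a g (r - 1) w0 := by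
    have : 0 < BAux.M φ a g (r - 1) w0 := (Set.ncard_pos (Set.toFinite _)).2 ⟨y0, hy0⟩
    exact this
  have hlow : BAux.M φ a g (r - 1) w0 ≤ tmin q r a b := by
    unfold tmin
    apply le_csInf
    · exact ⟨_, 0, 1, 0, by simp, rfl⟩
    · rintro m ⟨c, c0, d, hc, rfl⟩
      by_cases hc0 : c0 = 0
      · subst hc0
        have hc' : c ≠ 0 := fun h => hc ⟨h, rfl⟩
        refine (BAux.vert_ge φ a g hφ hg hag h2 w0 hmin c hc' d).trans (le_of_eq ?_)
        congr 1
        ext x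
        rw [Set.mem_inter_iff, hB]
        simp
      · refine (BAux.H_ge φ a g hφ hg hag ha h2 b hb' w0 hmin (fun i => -(c i / c0))
          (d / c0)).trans (le_of_eq ?_)
        rw [← hnv]
        congr 1
        ext x
        rw [Set.mem_inter_iff]
        refine and_congr_left fun _ => ?_
        have : ∑ i, -(c i / c0) * x.1 i = -(∑ i, c i * x.1 i) / c0 := by
          rw [neg_div, Finset.sum_div, ← Finset.sum_neg_distrib]
          refine Finset.sum_congr rfl fun i _ => ?_
          ring
        change _ = _ ↔ _ = _
        rw [this, ← add_div, eq_div_iff hc0]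
        constructor <;> intro h <;> linear_combination h
  refine ⟨hMpos.trans hlow, ?_⟩
  intro P hP
  obtain ⟨c, hc⟩ := BAux.through φ a g hφ hg hag w0 y0 hy0 P.1 P.2 ((hB P).1 hP)
  have hcount : ({x : (Fin (r - 1) → F) × F | (∑ i, (-c) i * x.1 i) + 1 * x.2
      = P.2 - ∑ i, c i * P.1 i} ∩ BSet q r a b).ncard = BAux.M φ a g (r - 1) w0 := by
    rw [← hc, ← hnv]
    congr 1
    ext x
    rw [Set.mem_inter_iff]
    refine and_congr_left fun _ => ?_
    change _ = _ ↔ _ = _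
    simp only [Pi.neg_apply, neg_mul, Finset.sum_neg_distrib]
    constructor <;> intro h <;> linear_combination h
  refine ⟨-c, 1, P.2 - ∑ i, c i * P.1 i, by simp, ?_, ?_⟩
  · simp only [Pi.neg_apply, neg_mul, Finset.sum_neg_distrib]; ring
  · refine le_antisymm (hcount.le.trans hlow) ?_
    exact Nat.sInf_le ⟨-c, 1, P.2 - ∑ i, c i * P.1 i, by simp, rfl⟩
end

section
/- Let q be an odd prime power, r ≥ 2 an even integer, a ∈ F\{0} and b ∈ F with b^q ≠ b, where F = GF(q²), and suppose 4a^{q+1} + (b^q − b)² is a non-zero square of the subfield GF(q) of F. Then B(a,b) has exactly q^{2r−1} points and for every affine hyperplane π of F^r the cardinality |π ∩ B(a,b)| belongs to the set { q^{2r−3} − q^{r−2}, q^{2r−3}, q^{2r−3} − q^{r−2} + q^{r−1} }. -/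
open Finset

lemma aux_linear_count {K : Type*} [Field K] [Fintype K] {m : ℕ} (c : Fin (m+1) → K) (hc : c ≠ 0)
    (d : K) : Nat.card {X : Fin (m+1) → K // ∑ i, c i * X i = d} = Nat.card K ^ m := by
  classical
  obtain ⟨j, hj⟩ : ∃ j, c j ≠ 0 := by
    by_contra h
    push Not at h
    exact hc (funext h)
  let e : Fin (m+1) → K := Pi.single j (c j)⁻¹
  have he : ∑ i, c i * e i = 1 := by
    rw [Finset.sum_eq_single j]
    · simp [e, hj]
    · intro i _ hi; simp [e, hi]
    · simp
  have hlin : ∀ (X : Fin (m+1) → K) (k : K), ∑ i, c i * (X i + k * e i) = ∑ i, c i * X i + k := by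
    intro X k
    calc _ = ∑ i, c i * X i + k * ∑ i, c i * e i := by
          rw [Finset.mul_sum, ← Finset.sum_add_distrib]
          exact Finset.sum_congr rfl fun i _ => by ring
      _ = _ := by rw [he, mul_one]
  let E : ({X : Fin (m+1) → K // ∑ i, c i * X i = d} × K) ≃ (Fin (m+1) → K) :=
    { toFun := fun p i => p.1.1 i + p.2 * e i
      invFun := fun X => (⟨fun i => X i + (-(∑ i, c i * X i - d)) * e i, by rw [hlin]; ring⟩,
        ∑ i, c i * X i - d)
      left_inv := by
        rintro ⟨⟨X, hX⟩, k⟩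
        refine Prod.ext (Subtype.ext (funext fun i => ?_)) ?_
        · simp only [hlin, hX]; ring
        · simp only [hlin, hX]; ring
      right_inv := by
        intro X
        funext i
        simp only
        ring }
  have h := Nat.card_congr E
  rw [Nat.card_prod, Nat.card_fun, Nat.card_eq_fintype_card (α := Fin (m+1)), Fintype.card_fin,
    pow_succ] at h
  exact Nat.eq_of_mul_eq_mul_right Nat.card_pos h

lemma aux_dot_count {K : Type*} [Field K] [Fintype K] (m : ℕ) (C : K) :
    Nat.card {p : (Fin (m+1) → K) × (Fin (m+1) → K) // ∑ i, p.1 i * p.2 i = C} ∈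
      ({Nat.card K ^ (2 * m + 1) - Nat.card K ^ m,
        Nat.card K ^ (2 * m + 1) - Nat.card K ^ m + Nat.card K ^ (m + 1)} : Set ℕ) := by
  classical
  have h1 : Nat.card {p : (Fin (m+1) → K) × (Fin (m+1) → K) // ∑ i, p.1 i * p.2 i = C}
      = ∑ s : Fin (m+1) → K, Nat.card {t : Fin (m+1) → K // ∑ i, s i * t i = C} := by
    rw [← Nat.card_sigma]
    exact Nat.card_congr
      { toFun := fun p => ⟨p.1.1, p.1.2, p.2⟩
        invFun := fun p => ⟨(p.1, p.2.1), p.2.2⟩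
        left_inv := fun _ => rfl
        right_inv := fun _ => rfl }
  have h2 : ∑ s ∈ univ.erase (0 : Fin (m+1) → K),
      Nat.card {t : Fin (m+1) → K // ∑ i, s i * t i = C}
      = Nat.card K ^ (2 * m + 1) - Nat.card K ^ m := by
    rw [Finset.sum_congr rfl fun s hs => aux_linear_count s (Finset.ne_of_mem_erase hs) C,
      Finset.sum_const, Finset.card_erase_of_mem (Finset.mem_univ _), Finset.card_univ,
      Fintype.card_fun, Fintype.card_fin, smul_eq_mul, Nat.sub_mul, Nat.card_eq_fintype_card,
      one_mul, ← pow_add]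
    congr 2; ring
  rw [h1, ← Finset.sum_erase_add _ _ (Finset.mem_univ 0), h2]
  by_cases hC : C = 0
  · right
    subst hC
    simp [Nat.card_eq_fintype_card]
  · left
    simp [Ne.symm hC]

/-- abstract count of zeros of a sum of hyperbolic planes plus an affine form. -/
lemma aux_hyp_count {K : Type*} [Field K] [Fintype K] (m : ℕ) (k C : K) (hk : k ≠ 0)
    (A B : Fin (m+1) → K) :
    Nat.card {p : (Fin (m+1) → K) × (Fin (m+1) → K) //
      ∑ i, (k * p.1 i * p.2 i + A i * p.1 i + B i * p.2 i) + C = 0} ∈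
      ({Nat.card K ^ (2 * m + 1) - Nat.card K ^ m,
        Nat.card K ^ (2 * m + 1) - Nat.card K ^ m + Nat.card K ^ (m + 1)} : Set ℕ) := by
  have key := aux_dot_count m (∑ i, A i * B i / k - C)
  convert key using 1
  let E : ((Fin (m+1) → K) × (Fin (m+1) → K)) ≃ ((Fin (m+1) → K) × (Fin (m+1) → K)) :=
    { toFun := fun p => (fun i => k * p.1 i + B i, fun i => p.2 i + A i / k)
      invFun := fun p => (fun i => (p.1 i - B i) / k, fun i => p.2 i - A i / k)
      left_inv := by
        intro p
        refine Prod.ext (funext fun i => ?_) (funext fun i => ?_)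
        · simp only; field_simp; ring
        · simp only; ring
      right_inv := by
        intro p
        refine Prod.ext (funext fun i => ?_) (funext fun i => ?_)
        · simp only; field_simp; ring
        · simp only; ring }
  refine Nat.card_congr (E.subtypeEquiv fun p => ?_)
  have : ∑ i, (E p).1 i * (E p).2 i
      = ∑ i, (k * p.1 i * p.2 i + A i * p.1 i + B i * p.2 i) + ∑ i, A i * B i / k := by
    rw [← Finset.sum_add_distrib]
    refine Finset.sum_congr rfl fun i _ => ?_
    simp only [E, Equiv.coe_fn_mk]
    field_simp
    ring
  rw [this]
  constructor <;> intro h <;> linear_combination h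

/-- the fixed subfield of an endomorphism. -/
abbrev auxK {F : Type*} [Field F] (φ : F →+* F) : Subfield F := φ.eqLocusField (RingHom.id F)

lemma auxK_mem {F : Type*} [Field F] (φ : F →+* F) (x : F) : x ∈ auxK φ ↔ φ x = x := Iff.rfl

lemma auxK_card {F : Type*} [Field F] [Fintype F] (φ : F →+* F) (hφ : ∀ x, φ (φ x) = x)
    (h2 : (2 : F) ≠ 0) (β : F) (hβ : φ β = -β) (hβ0 : β ≠ 0) :
    Nat.card F = Nat.card (auxK φ) ^ 2 := by
  let E : F ≃ auxK φ × auxK φ :=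
    { toFun := fun x => (⟨(x + φ x) / 2, by
          rw [auxK_mem]; simp only [map_div₀, map_add, hφ, map_ofNat]; ring⟩,
        ⟨(x - φ x) / (2 * β), by
          rw [auxK_mem]; simp only [map_div₀, map_sub, map_mul, hφ, map_ofNat, hβ]
          field_simp; ring⟩)
      invFun := fun p => p.1.1 + β * p.2.1
      left_inv := by
        intro x
        simp only
        field_simp
        ring
      right_inv := by
        rintro ⟨⟨s, hs⟩, ⟨t, ht⟩⟩
        rw [auxK_mem] at hs ht
        refine Prod.ext (Subtype.ext ?_) (Subtype.ext ?_)
        · simp only [map_add, map_mul, hs, ht, hβ]; field_simp; ring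
        · simp only [map_add, map_mul, hs, ht, hβ]; field_simp; ring }
  rw [Nat.card_congr E, Nat.card_prod, sq]

lemma aux_h90 {F : Type*} [Field F] (φ : F →+* F)
    (β : F) (hβ : φ β = -β) (hβ0 : β ≠ 0) (u : F) (hu : u * φ u = 1) :
    ∃ w, w ≠ 0 ∧ φ w = u * w := by
  have hu0 : u ≠ 0 := left_ne_zero_of_mul_eq_one hu
  by_cases h : u = -1
  · exact ⟨β, hβ0, by rw [hβ, h]; ring⟩
  · refine ⟨1 + φ u, ?_, ?_⟩
    · intro h0
      apply h
      have : u * (1 + φ u) = 0 := by rw [h0, mul_zero]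
      rw [mul_add, hu] at this
      linear_combination this
    · have hh : φ u = u⁻¹ := eq_inv_of_mul_eq_one_right hu
      rw [map_add, map_one, hh, map_inv₀, hh]
      field_simp
      ring

lemma aux_basis {F : Type*} [Field F] [Fintype F] (φ : F →+* F) (hφ : ∀ x, φ (φ x) = x)
    (h2 : (2 : F) ≠ 0) (β : F) (hβ : φ β = -β) (hβ0 : β ≠ 0) (a s : F) (ha : a ≠ 0)
    (hs0 : s ≠ 0) (hs : φ s = s) (hab : 4 * (a * φ a) + β ^ 2 = s ^ 2) :
    ∃ (w₁ w₂ k : F), k ≠ 0 ∧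
      Function.Bijective (fun p : auxK φ × auxK φ => (p.1 : F) * w₁ + (p.2 : F) * w₂) ∧
      ∀ p : auxK φ × auxK φ, ∀ x, x = (p.1 : F) * w₁ + (p.2 : F) * w₂ →
        φ a * (φ x) ^ 2 - a * x ^ 2 - β * (x * φ x) = k * p.1 * p.2 := by
  have hφa : φ a ≠ 0 := by simpa using ha
  have hN : ∀ e : F, (e = s ∨ e = -s) → ((β + e) / (2 * φ a)) * φ ((β + e) / (2 * φ a)) = 1 := by
    intro e he
    have h1 : φ e = e := by rcases he with rfl | rfl <;> simp [hs]
    have h3 : e ^ 2 = s ^ 2 := by rcases he with rfl | rfl <;> ring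
    simp only [map_div₀, map_add, map_mul, map_ofNat, hφ, hβ, h1]
    field_simp
    linear_combination h3 - hab
  obtain ⟨w₁, hw₁, hw₁'⟩ := aux_h90 φ β hβ hβ0 _ (hN s (Or.inl rfl))
  obtain ⟨w₂, hw₂, hw₂'⟩ := aux_h90 φ β hβ hβ0 _ (hN (-s) (Or.inr rfl))
  set u₁ := (β + s) / (2 * φ a) with hu₁
  set u₂ := (β + -s) / (2 * φ a) with hu₂
  have hd : u₁ - u₂ = s / φ a := by rw [hu₁, hu₂]; field_simp; ring
  have hd0 : u₁ - u₂ ≠ 0 := by rw [hd]; exact div_ne_zero hs0 hφa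
  have hsum : φ a * (u₁ + u₂) = β := by rw [hu₁, hu₂]; field_simp; ring
  have hprod : φ a * (u₁ * u₂) = -a := by
    rw [hu₁, hu₂]; field_simp; linear_combination hab
  clear_value u₁ u₂
  refine ⟨w₁, w₂, -(φ a * (u₁ - u₂) ^ 2 * w₁ * w₂), ?_, ?_, ?_⟩
  · simp [hφa, hd0, hw₁, hw₂]
  · refine (Nat.bijective_iff_injective_and_card _).mpr ⟨?_, ?_⟩
    · rintro ⟨⟨x, hx⟩, ⟨y, hy⟩⟩ ⟨⟨x', hx'⟩, ⟨y', hy'⟩⟩ h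
      rw [auxK_mem] at hx hy hx' hy'
      simp only at h
      have h' := congrArg φ h
      simp only [map_add, map_mul, hx, hy, hx', hy', hw₁', hw₂'] at h'
      have e1 : (u₁ - u₂) * w₁ * (x - x') = 0 := by linear_combination h' - u₂ * h
      have e2 : (u₁ - u₂) * w₂ * (y - y') = 0 := by linear_combination u₁ * h - h'
      simp only [mul_eq_zero, hd0, hw₁, hw₂, false_or] at e1 e2
      refine Prod.ext (Subtype.ext (sub_eq_zero.mp e1)) (Subtype.ext (sub_eq_zero.mp e2))
    · rw [Nat.card_prod, auxK_card φ hφ h2 β hβ hβ0, sq]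
  · rintro ⟨⟨x, hx⟩, ⟨y, hy⟩⟩ z rfl
    rw [auxK_mem] at hx hy
    simp only [map_add, map_mul, hx, hy, hw₁', hw₂']
    linear_combination -(x * w₁ + y * w₂) ^ 2 * hprod +
      (x * w₁ + y * w₂) * (x * (u₁ * w₁) + y * (u₂ * w₂)) * hsum

lemma aux_hyperplane {F : Type*} [Field F] [Fintype F] (φ : F →+* F) (hφ : ∀ x, φ (φ x) = x)
    (h2 : (2 : F) ≠ 0) (a b s : F) (ha : a ≠ 0) (hb : φ b ≠ b)
    (hs0 : s ≠ 0) (hs : φ s = s) (hab : 4 * (a * φ a) + (φ b - b) ^ 2 = s ^ 2)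
    (m : ℕ) (μ : Fin (m+1) → F) (δ : F) :
    Nat.card {X : Fin (m+1) → F // φ δ - δ + ∑ i, (φ (μ i * X i) - μ i * X i
      + (φ a * (φ (X i)) ^ 2 - a * (X i) ^ 2 - (φ b - b) * (X i * φ (X i)))) = 0} ∈
      ({Nat.card (auxK φ) ^ (2 * m + 1) - Nat.card (auxK φ) ^ m,
        Nat.card (auxK φ) ^ (2 * m + 1) - Nat.card (auxK φ) ^ m
          + Nat.card (auxK φ) ^ (m + 1)} : Set ℕ) := by
  classical
  have hβ : φ (φ b - b) = -(φ b - b) := by rw [map_sub, hφ]; ring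
  have hβ0 : φ b - b ≠ 0 := sub_ne_zero.mpr hb
  obtain ⟨w₁, w₂, k, hk, hbij, hform⟩ := aux_basis φ hφ h2 (φ b - b) hβ hβ0 a s ha hs0 hs hab
  generalize hβe : φ b - b = β at *
  have hanti : ∀ z : F, φ z = -z → z / β ∈ auxK φ := by
    intro z hz
    rw [auxK_mem, map_div₀, hz, hβ, neg_div_neg_eq]
  have hD : ∀ z : F, (φ z - z) / β ∈ auxK φ := fun z => hanti _ (by rw [map_sub, hφ]; ring)
  have hkK : k / β ∈ auxK φ := by
    apply hanti
    have h := hform (1, 1) _ rfl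
    simp only [OneMemClass.coe_one, mul_one, one_mul] at h
    rw [← h]
    simp only [map_sub, map_mul, map_pow, hφ, hβ]
    ring
  have key := aux_hyp_count (K := auxK φ) m ⟨k / β, hkK⟩ ⟨_, hD δ⟩
    (by simpa [Subtype.ext_iff] using ⟨hk, hβ0⟩)
    (fun i => ⟨_, hD (μ i * w₁)⟩) (fun i => ⟨_, hD (μ i * w₂)⟩)
  convert key using 1
  symm
  let e := Equiv.ofBijective _ hbij
  let E : ((Fin (m+1) → auxK φ) × (Fin (m+1) → auxK φ)) ≃ (Fin (m+1) → F) :=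
    (Equiv.arrowProdEquivProdArrow (Fin (m+1)) (fun _ => auxK φ) (fun _ => auxK φ)).symm.trans
      (Equiv.arrowCongr (Equiv.refl _) e)
  have hE : ∀ p i, E p i = (p.1 i : F) * w₁ + (p.2 i : F) * w₂ := fun p i => rfl
  refine Nat.card_congr (E.subtypeEquiv fun p => ?_)
  rw [Subtype.ext_iff]
  have : φ δ - δ + ∑ i, (φ (μ i * E p i) - μ i * E p i
      + (φ a * (φ (E p i)) ^ 2 - a * (E p i) ^ 2 - β * (E p i * φ (E p i))))
      = β * (∑ i, ((k / β) * p.1 i * p.2 i + (φ (μ i * w₁) - μ i * w₁) / β * p.1 i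
        + (φ (μ i * w₂) - μ i * w₂) / β * p.2 i) + (φ δ - δ) / β) := by
    rw [mul_add, mul_div_cancel₀ _ hβ0, add_comm, Finset.mul_sum]
    congr 1
    refine Finset.sum_congr rfl fun i _ => ?_
    rw [hform (p.1 i, p.2 i) (E p i) (hE p i), hE]
    have h1 : φ (p.1 i) = p.1 i := (p.1 i).2
    have h2 : φ (p.2 i) = p.2 i := (p.2 i).2
    simp only [map_add, map_mul, h1, h2]
    field_simp
    ring
  rw [this, mul_eq_zero, or_iff_right hβ0]
  push_cast
  rfl

theorem statement7 (q r : ℕ) (hq : IsPrimePow q) (hqodd : Odd q)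
    (hr : 2 ≤ r) (hreven : Even r)
    {F : Type*} [Field F] [Fintype F] (hF : Fintype.card F = q ^ 2)
    (a b : F) (ha : a ≠ 0) (hb : b ^ q ≠ b)
    (hab : ∃ s : F, s ≠ 0 ∧ s ^ q = s ∧ 4 * a ^ (q + 1) + (b ^ q - b) ^ 2 = s ^ 2) :
    (BSet q r a b).ncard = q ^ (2 * r - 1) ∧
    ∀ (c : Fin (r - 1) → F) (c0 d : F), ¬(c = 0 ∧ c0 = 0) →
      (({x : (Fin (r - 1) → F) × F | (∑ i, c i * x.1 i) + c0 * x.2 = d}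
          ∩ BSet q r a b)).ncard ∈
        ({q ^ (2 * r - 3) - q ^ (r - 2), q ^ (2 * r - 3),
          q ^ (2 * r - 3) - q ^ (r - 2) + q ^ (r - 1)} : Set ℕ) := by
  classical
  obtain ⟨φ, hφq⟩ : ∃ φ : F →+* F, ∀ x, φ x = x ^ q := by
    obtain ⟨p, k, hp, hk, rfl⟩ := hq
    have : Fact p.Prime := ⟨hp.nat_prime⟩
    have : CharP F p := charP_of_card_eq_prime_pow (f := k * 2) (by rw [hF, pow_mul])
    exact ⟨iterateFrobenius F p k, fun x => rfl⟩
  have hφ : ∀ x, φ (φ x) = x := fun x => by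
    rw [hφq, hφq, ← pow_mul, ← sq, ← hF, FiniteField.pow_card]
  have h2 : (2 : F) ≠ 0 := by
    apply Ring.two_ne_zero
    intro h
    have h1 := FiniteField.even_card_of_char_two h
    rw [hF] at h1
    have := hqodd.pow (n := 2)
    rw [Nat.odd_iff] at this
    omega
  obtain ⟨s, hs0, hs, hab⟩ := hab
  rw [pow_succ, ← hφq, ← hφq, mul_comm (φ a)] at hab
  rw [← hφq] at hs hb
  have hβ : φ (φ b - b) = -(φ b - b) := by rw [map_sub, hφ]; ring
  have hβ0 : φ b - b ≠ 0 := sub_ne_zero.mpr hb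
  have hFc : Nat.card F = q ^ 2 := by rw [Nat.card_eq_fintype_card, hF]
  have hK : Nat.card (auxK φ) = q := by
    have := auxK_card φ hφ h2 _ hβ hβ0
    rw [hFc] at this
    exact (Nat.pow_left_injective two_ne_zero this).symm
  obtain ⟨m, rfl⟩ : ∃ m, r = m + 2 := ⟨r - 2, by omega⟩
  have e1 : 2 * (m + 2) - 1 = 2 * (m + 1) + 1 := by omega
  have e2 : 2 * (m + 2) - 3 = 2 * m + 1 := by omega
  have e3 : m + 2 - 2 = m := by omega
  rw [e1, e2, e3]
  change (BSet q (m+2) a b).ncard = _ ∧ ∀ (c : Fin (m + 1) → F) (c0 d : F), ¬(c = 0 ∧ c0 = 0) →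
      (({x : (Fin (m + 1) → F) × F | (∑ i, c i * x.1 i) + c0 * x.2 = d}
          ∩ BSet q (m+2) a b)).ncard ∈
        ({q ^ (2 * m + 1) - q ^ m, q ^ (2 * m + 1),
          q ^ (2 * m + 1) - q ^ m + q ^ (m + 1)} : Set ℕ)
  -- membership in `BSet`
  have hmem : ∀ x : (Fin (m + 1) → F) × F, x ∈ BSet q (m+2) a b ↔
      φ x.2 - x.2 + ∑ i, (φ a * (φ (x.1 i)) ^ 2 - a * (x.1 i) ^ 2
        - (φ b - b) * (x.1 i * φ (x.1 i))) = 0 := by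
    intro x
    have : x ∈ BSet q (m+2) a b ↔ x.2 ^ q - x.2 + a ^ q * (∑ i : Fin (m+1), x.1 i ^ (2 * q))
      - a * (∑ i : Fin (m+1), x.1 i ^ 2) = (b ^ q - b) * ∑ i : Fin (m+1), x.1 i ^ (q + 1) := Iff.rfl
    rw [this]
    simp only [Finset.sum_sub_distrib, ← Finset.mul_sum, hφq]
    simp only [← pow_mul, mul_comm q 2, ← pow_succ']
    constructor <;> intro h <;> linear_combination h
  have hmem2 : ∀ x : (Fin (m + 1) → F) × F, x ∈ BSet q (m+2) a b ↔
      x.2 + ∑ i, (a * (x.1 i) ^ 2 - b * (x.1 i * φ (x.1 i))) ∈ auxK φ := by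
    intro x
    rw [hmem, auxK_mem, map_add, map_sum, ← sub_eq_zero (b := _ + _), add_sub_add_comm,
      ← Finset.sum_sub_distrib]
    have : ∀ i, φ a * (φ (x.1 i)) ^ 2 - a * (x.1 i) ^ 2 - (φ b - b) * (x.1 i * φ (x.1 i))
      = φ (a * (x.1 i) ^ 2 - b * (x.1 i * φ (x.1 i)))
        - (a * (x.1 i) ^ 2 - b * (x.1 i * φ (x.1 i))) := by
      intro i
      simp only [map_sub, map_mul, map_pow, hφ]
      ring
    simp only [this]
  -- points with prescribed first coordinates
  have hcyl : ∀ P : (Fin (m+1) → F) → Prop,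
      ({x : (Fin (m + 1) → F) × F | P x.1} ∩ BSet q (m+2) a b).ncard
        = Nat.card {X : Fin (m+1) → F // P X} * q := by
    intro P
    have hE : Nat.card ↥({x : (Fin (m + 1) → F) × F | P x.1} ∩ BSet q (m+2) a b)
        = Nat.card ({X : Fin (m+1) → F // P X} × auxK φ) := Nat.card_congr
      { toFun := fun x => (⟨x.1.1, x.2.1⟩, ⟨_, (hmem2 x.1).mp x.2.2⟩)
        invFun := fun y => ⟨(y.1.1,
          y.2.1 - ∑ i, (a * (y.1.1 i) ^ 2 - b * (y.1.1 i * φ (y.1.1 i)))),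
          y.1.2, by rw [hmem2]; simp only [sub_add_cancel]; exact y.2.2⟩
        left_inv := by
          rintro ⟨⟨X, y⟩, hx⟩
          simp
        right_inv := by
          rintro ⟨⟨X, hX⟩, ⟨y, hy⟩⟩
          simp }
    rw [← Nat.card_coe_set_eq, hE, Nat.card_prod, hK]
  refine ⟨?_, ?_⟩
  · have h := hcyl (fun _ => True)
    have hu : {x : (Fin (m + 1) → F) × F | (fun _ => True) x.1} = Set.univ := by ext; simp
    rw [hu, Set.univ_inter] at h
    rw [h, Nat.card_congr (Equiv.subtypeUnivEquiv fun _ => trivial), Nat.card_fun, hFc,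
      Nat.card_eq_fintype_card, Fintype.card_fin, ← pow_mul, ← pow_succ]
  · intro c c0 d hc
    by_cases hc0 : c0 = 0
    · right; left
      subst hc0
      have hc' : c ≠ 0 := fun h => hc ⟨h, rfl⟩
      have h := hcyl (fun X => ∑ i, c i * X i = d)
      simp only [zero_mul, add_zero]
      rw [h, aux_linear_count c hc' d, hFc, ← pow_mul, ← pow_succ]
    · have key := aux_hyperplane φ hφ h2 a b s ha hb hs0 hs hab m (fun i => -(c i / c0)) (d / c0)
      rw [hK] at key
      have hsol : ∀ (X : Fin (m+1) → F) (y : F), ∑ i, c i * X i + c0 * y = d ↔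
          y = d / c0 + ∑ i, -(c i / c0) * X i := by
        intro X y
        have : ∑ i, -(c i / c0) * X i = -(∑ i, c i * X i) / c0 := by
          rw [← Finset.sum_neg_distrib, Finset.sum_div]
          exact Finset.sum_congr rfl fun i _ => by ring
        rw [this]
        constructor
        · intro h; rw [← h]; field_simp; ring
        · rintro rfl; field_simp; ring
      have hmem3 : ∀ X : Fin (m+1) → F,
          (X, d / c0 + ∑ i, -(c i / c0) * X i) ∈ BSet q (m+2) a b ↔
          φ (d / c0) - d / c0 + ∑ i, (φ (-(c i / c0) * X i) - -(c i / c0) * X i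
            + (φ a * (φ (X i)) ^ 2 - a * (X i) ^ 2 - (φ b - b) * (X i * φ (X i)))) = 0 := by
        intro X
        rw [hmem]
        simp only [Finset.sum_add_distrib, Finset.sum_sub_distrib, map_add, map_sum]
        constructor <;> intro h <;> linear_combination h
      have hcard : ({x : (Fin (m + 1) → F) × F | (∑ i, c i * x.1 i) + c0 * x.2 = d}
          ∩ BSet q (m+2) a b).ncard = Nat.card {X : Fin (m+1) → F //
          φ (d / c0) - d / c0 + ∑ i, (φ (-(c i / c0) * X i) - -(c i / c0) * X i
            + (φ a * (φ (X i)) ^ 2 - a * (X i) ^ 2 - (φ b - b) * (X i * φ (X i)))) = 0} := by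
        rw [← Nat.card_coe_set_eq]
        exact Nat.card_congr
          { toFun := fun x => ⟨x.1.1, by
              have h1 := (hsol _ _).mp x.2.1
              rw [← hmem3, ← h1]
              exact x.2.2⟩
            invFun := fun X => ⟨(X.1, d / c0 + ∑ i, -(c i / c0) * X.1 i),
              (hsol _ _).mpr rfl, (hmem3 _).mpr X.2⟩
            left_inv := by
              rintro ⟨⟨X, y⟩, hx⟩
              have h1 := (hsol _ _).mp hx.1
              exact Subtype.ext (Prod.ext rfl h1.symm)
            right_inv := fun _ => rfl }
      rw [hcard]
      rcases key with h | h
      · left; exact h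
      · right; right; exact h
end

section
/- Let q = 2^h be an even prime power, r ≥ 2 an even integer, a ∈ F\{0} and b ∈ F with b^q ≠ b, where F = GF(q²), and suppose Tr_q(a^{q+1}/(b^q + b)²) = 1, where Tr_q : GF(q) → GF(2) is the absolute trace map x ↦ x + x² + x^{2²} + ⋯ + x^{2^{h−1}}. Then B(a,b) has exactly q^{2r−1} points and for every affine hyperplane π of F^r the cardinality |π ∩ B(a,b)| belongs to the set { q^{2r−3} − q^{r−2}, q^{2r−3}, q^{2r−3} − q^{r−2} + q^{r−1} }. -/
open Finset

section helpers
variable {F : Type*} [Field F] [Fintype F] [DecidableEq F]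

lemma fiber_mul {G H : Type*} [AddGroup G] [AddGroup H] [Fintype G] [Fintype H] [DecidableEq H]
    (φ : G →+ H) (k : H) (hk : k ∈ Set.range φ) :
    (univ.filter fun y => φ y = k).card * (univ.image φ).card = Fintype.card G := by
  have h1 := Finset.card_eq_sum_card_image φ (univ : Finset G)
  rw [Finset.card_univ] at h1
  rw [h1, Finset.sum_congr rfl (g := fun _ => (univ.filter fun y => φ y = k).card), sum_const,
    smul_eq_mul, mul_comm]
  intro z hz
  apply AddMonoidHom.card_fiber_eq_of_mem_range φ _ hk
  obtain ⟨y, -, hy⟩ := Finset.mem_image.1 hz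
  exact ⟨y, hy⟩

lemma root_bound (q : ℕ) (hq : 2 ≤ q) (t : F) :
    (univ.filter fun y : F => y ^ q + t * y = 0).card ≤ q := by
  classical
  set p : Polynomial F := Polynomial.X ^ q + Polynomial.C t * Polynomial.X with hp
  have hdeg : p.natDegree = q := by
    have h1 : (Polynomial.C t * Polynomial.X : Polynomial F).natDegree < (Polynomial.X ^ q : Polynomial F).natDegree := by
      rw [Polynomial.natDegree_X_pow]
      exact (Polynomial.natDegree_C_mul_le _ _).trans_lt (by rw [Polynomial.natDegree_X]; omega)
    rw [hp, Polynomial.natDegree_add_eq_left_of_natDegree_lt h1, Polynomial.natDegree_X_pow]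
  have hp0 : p ≠ 0 := by
    intro h0; rw [h0] at hdeg; simp at hdeg; omega
  calc _ ≤ p.roots.toFinset.card := by
        apply Finset.card_le_card
        intro y hy
        simp only [mem_filter, mem_univ, true_and] at hy
        rw [Multiset.mem_toFinset, Polynomial.mem_roots hp0]
        simp [hp, hy]
    _ ≤ _ := (Multiset.toFinset_card_le _).trans ((Polynomial.card_roots' p).trans hdeg.le)

lemma fiber_q [CharP F 2] (q h : ℕ) (hqh : q = 2 ^ h) (hq : 2 ≤ q)
    (hF : Fintype.card F = q ^ 2) (t k : F) (ht : t ^ (q + 1) = 1) (hk : k ^ q = t ^ q * k) :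
    (univ.filter fun y : F => y ^ q + t * y = k).card = q := by
  have hadd : ∀ x y : F, (x + y) ^ q = x ^ q + y ^ q := by
    intro x y; rw [hqh]; exact add_pow_char_pow x y 2 h
  have hqq : ∀ x : F, (x ^ q) ^ q = x := by
    intro x; rw [← pow_mul, ← sq, ← hF]; exact FiniteField.pow_card x
  let φ : F →+ F :=
    { toFun := fun y => y ^ q + t * y
      map_zero' := by simp; omega
      map_add' := fun x y => by simp only [hadd]; ring }
  have hφ : ∀ y, φ y = y ^ q + t * y := fun _ => rfl
  have hker : (univ.filter fun y => φ y = 0).card ≤ q := root_bound q hq t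
  have hsub : univ.image φ ⊆ univ.filter fun y => y ^ q + (t ^ q) * y = 0 := by
    intro z hz
    obtain ⟨y, -, rfl⟩ := Finset.mem_image.1 hz
    simp only [mem_filter, mem_univ, true_and, hφ, hadd, mul_pow, hqq]
    have : t ^ q * t = 1 := by rw [← pow_succ]; exact ht
    have h2 : (2 : F) = 0 := CharTwo.two_eq_zero
    linear_combination y * this + (y + t ^ q * y ^ q) * h2
  have him := root_bound q hq (t ^ q)
  have him' := (Finset.card_le_card hsub).trans him
  have h0 := fiber_mul φ 0 ⟨0, map_zero φ⟩
  rw [hF] at h0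
  have hi : (univ.image φ).card = q := by
    apply le_antisymm him'
    by_contra hlt
    push Not at hlt
    nlinarith
  have heq := Finset.eq_of_subset_of_card_le hsub (by omega)
  have hkm : k ∈ univ.image φ := by
    rw [heq]; simp only [mem_filter, mem_univ, true_and, hk]
    exact CharTwo.add_self_eq_zero _
  obtain ⟨y, -, hy⟩ := Finset.mem_image.1 hkm
  have h3 := fiber_mul φ k ⟨y, hy⟩
  rw [hF, hi, sq] at h3
  exact Nat.eq_of_mul_eq_mul_right (by omega) h3

lemma exists_root [CharP F 2] (q h : ℕ) (hqh : q = 2 ^ h)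
    (hF : Fintype.card F = q ^ 2) (c : F)
    (htr : ∑ i ∈ Finset.range h, c ^ 2 ^ i = 1) : ∃ s : F, s ^ 2 + s = c ∧ s ^ q = s + 1 := by
  let K := AlgebraicClosure F
  have : CharP K 2 := charP_of_injective_algebraMap (algebraMap F K).injective 2
  obtain ⟨s, hs⟩ : ∃ s : K, s ^ 2 + s = algebraMap F K c := by
    have := IsAlgClosed.exists_root
      (Polynomial.X ^ 2 + Polynomial.X - Polynomial.C (algebraMap F K c)) (by
        have : (Polynomial.X ^ 2 + Polynomial.X - Polynomial.C (algebraMap F K c)).degree = 2 := by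
          compute_degree!
        rw [this]; norm_num)
    obtain ⟨s, hs⟩ := this
    refine ⟨s, ?_⟩
    simpa [sub_eq_zero] using hs
  have hpow : ∀ i, s ^ 2 ^ i = s + algebraMap F K (∑ j ∈ range i, c ^ 2 ^ j) := by
    intro i
    induction i with
    | zero => simp
    | succ i ih =>
      have h1 : s ^ 2 ^ (i + 1) = (s ^ 2) ^ 2 ^ i := by rw [← pow_mul, pow_succ']
      have h2 : s ^ 2 = s + algebraMap F K c := by
        rw [← hs]; linear_combination (- s) * (CharTwo.two_eq_zero : (2 : K) = 0)
      rw [h1, h2, add_pow_char_pow, ih, Finset.sum_range_succ, map_add, map_pow]; ring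
  have hsq : s ^ q = s + 1 := by rw [hqh, hpow, htr, map_one]
  have hsqq : s ^ Fintype.card F = s := by
    have : (s + 1) ^ q = s ^ q + 1 := by
      rw [hqh, add_pow_char_pow, one_pow]
    rw [hF, sq, pow_mul, hsq, this, hsq]
    linear_combination (CharTwo.two_eq_zero : (2 : K) = 0)
  obtain ⟨s', rfl⟩ : ∃ s' : F, algebraMap F K s' = s := by
    have hcard := Fintype.one_lt_card (α := F)
    have hsp : (Polynomial.X ^ Fintype.card F - Polynomial.X : Polynomial F).Splits := by
      rw [Polynomial.splits_iff_card_roots, FiniteField.roots_X_pow_card_sub_X,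
        FiniteField.X_pow_card_sub_X_natDegree_eq _ hcard]
      rfl
    have := FiniteField.roots_X_pow_card_sub_X F ▸
      hsp.roots_map (algebraMap F K) ▸ Multiset.mem_map (b := s)
    simpa [sub_eq_zero, hsqq, FiniteField.X_pow_card_sub_X_ne_zero K hcard] using this
  refine ⟨s', ?_, ?_⟩
  · apply (algebraMap F K).injective; simpa using hs
  · apply (algebraMap F K).injective; simpa using hsq


/-- the one variable quadratic form -/
def qf (q : ℕ) (a β y : F) : F := a ^ q * y ^ (2 * q) + a * y ^ 2 + β * y ^ (q + 1)

lemma qf_frob [CharP F 2] (q h : ℕ) (hqh : q = 2 ^ h)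
    (hF : Fintype.card F = q ^ 2) (a β y : F) (hβ : β ^ q = β) :
    (qf q a β y) ^ q = qf q a β y := by
  have hadd : ∀ x y : F, (x + y) ^ q = x ^ q + y ^ q := by
    intro x y; rw [hqh]; exact add_pow_char_pow x y 2 h
  have hqq : ∀ x : F, (x ^ q) ^ q = x := by
    intro x; rw [← pow_mul, ← sq, ← hF]; exact FiniteField.pow_card x
  have h1 : (y ^ (2 * q)) ^ q = y ^ 2 := by rw [pow_mul, hqq]
  have h2 : (y ^ (q + 1)) ^ q = y ^ (q + 1) := by rw [pow_succ, mul_pow, hqq, mul_comm]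
  have h3 : (y ^ 2) ^ q = y ^ (2 * q) := by rw [pow_mul]
  simp only [qf, hadd, mul_pow, hqq, h1, h2, h3, hβ]
  ring

lemma qf_zero_count [CharP F 2] (q h : ℕ) (hqh : q = 2 ^ h) (hq : 2 ≤ q)
    (hF : Fintype.card F = q ^ 2) (a β : F) (ha : a ≠ 0) (hβ0 : β ≠ 0) (hβ : β ^ q = β)
    (htr : ∑ i ∈ Finset.range h, (a ^ (q + 1) / β ^ 2) ^ 2 ^ i = 1) :
    (univ.filter fun y => qf q a β y = 0).card + 1 = 2 * q := by
  have hqq : ∀ x : F, (x ^ q) ^ q = x := by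
    intro x; rw [← pow_mul, ← sq, ← hF]; exact FiniteField.pow_card x
  have hone : (1 : F) ^ q = 1 := one_pow q
  have hadd : ∀ x y : F, (x + y) ^ q = x ^ q + y ^ q := by
    intro x y; rw [hqh]; exact add_pow_char_pow x y 2 h
  have h2 : (2 : F) = 0 := CharTwo.two_eq_zero
  obtain ⟨s, hs, hsq⟩ := exists_root q h hqh hF _ htr
  have haq : a ^ q ≠ 0 := pow_ne_zero _ ha
  have hs' : β ^ 2 * (s ^ 2 + s) = a ^ q * a := by
    rw [hs, ← pow_succ]; field_simp
  set t1 := β * s / a ^ q with ht1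
  set t2 := β * (s + 1) / a ^ q with ht2
  have e1 : t1 ^ (q + 1) = 1 := by
    rw [pow_succ, ht1, div_pow, mul_pow, hβ, hsq, hqq]
    field_simp
    linear_combination hs'
  have e2 : t2 ^ (q + 1) = 1 := by
    rw [pow_succ, ht2, div_pow, mul_pow, hβ, hadd, hsq, hone, hqq]
    field_simp
    linear_combination hs' + β ^ 2 * (s + 1) * h2
  have e3 : t1 ≠ t2 := by
    intro h12
    rw [ht1, ht2, div_left_inj' haq, mul_right_inj' hβ0] at h12
    simp at h12
  have hfac : ∀ y, qf q a β y = a ^ q * ((y ^ q + t1 * y) * (y ^ q + t2 * y)) := by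
    intro y
    have hb : t1 + t2 = β / a ^ q := by
      rw [ht1, ht2]; field_simp; linear_combination s * h2
    have hc : t1 * t2 = a / a ^ q := by
      rw [ht1, ht2]; field_simp; linear_combination hs'
    have : (y ^ q + t1 * y) * (y ^ q + t2 * y)
        = y ^ (2 * q) + (t1 + t2) * (y ^ q * y) + (t1 * t2) * y ^ 2 := by ring
    rw [this, hb, hc, qf]; field_simp; ring
  have hU : (univ.filter fun y => qf q a β y = 0) =
      (univ.filter fun y : F => y ^ q + t1 * y = 0) ∪
      (univ.filter fun y : F => y ^ q + t2 * y = 0) := by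
    ext y; simp [hfac, ha]
  have hI : (univ.filter fun y : F => y ^ q + t1 * y = 0) ∩
      (univ.filter fun y : F => y ^ q + t2 * y = 0) = {0} := by
    ext y
    simp only [mem_inter, mem_filter, mem_univ, true_and, mem_singleton]
    constructor
    · rintro ⟨h1, h3⟩
      have : (t1 - t2) * y = 0 := by linear_combination h1 - h3
      exact (mul_eq_zero.1 this).resolve_left (sub_ne_zero.2 e3)
    · rintro rfl
      simp; omega
  have hc := Finset.card_union_add_card_inter (univ.filter fun y : F => y ^ q + t1 * y = 0)
      (univ.filter fun y : F => y ^ q + t2 * y = 0)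
  rw [← hU, hI, card_singleton, fiber_q q h hqh hq hF t1 0 e1 (by simp; omega),
    fiber_q q h hqh hq hF t2 0 e2 (by simp; omega)] at hc
  omega

lemma qf_count [CharP F 2] (q h : ℕ) (hqh : q = 2 ^ h) (hq : 2 ≤ q)
    (hF : Fintype.card F = q ^ 2) (a β : F) (ha : a ≠ 0) (hβ0 : β ≠ 0) (hβ : β ^ q = β)
    (htr : ∑ i ∈ Finset.range h, (a ^ (q + 1) / β ^ 2) ^ 2 ^ i = 1) (k : F) (hk : k ^ q = k) :
    ((univ.filter fun y => qf q a β y = k).card : ℤ) = q - 1 + if k = 0 then (q : ℤ) else 0 := by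
  have h2 : (2 : F) = 0 := CharTwo.two_eq_zero
  have h0 := qf_zero_count q h hqh hq hF a β ha hβ0 hβ htr
  split_ifs with hk0
  · subst hk0; zify at h0; linarith
  have hS : (univ.filter fun y : F => y ^ q = y).card = q := by
    have := fiber_q q h hqh hq hF 1 0 (by simp) (by simp; omega)
    simpa only [one_mul, CharTwo.add_eq_zero] using this
  have hscale : ∀ m : F, m ^ q = m → m ≠ 0 → (univ.filter fun y => qf q a β y = m).card
      = (univ.filter fun y => qf q a β y = 1).card := by
    intro m hm hm0
    obtain ⟨l, hl⟩ : ∃ l : F, l ^ 2 = m := by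
      obtain ⟨l, hl⟩ := (Finite.injective_iff_surjective.1 (frobenius_inj F 2)) m
      exact ⟨l, hl⟩
    have hl0 : l ≠ 0 := by rintro rfl; apply hm0; rw [← hl]; simp
    have hlq : l ^ q = l := by
      apply frobenius_inj F 2
      simp only [frobenius_def]
      rw [← pow_mul, mul_comm, pow_mul, hl, hm]
    have hsc : ∀ y, qf q a β (l * y) = m * qf q a β y := by
      intro y
      have h1 : l ^ (2 * q) = m := by rw [pow_mul, hl, hm]
      have h3 : l ^ (q + 1) = m := by rw [pow_succ, hlq, ← sq, hl]
      simp only [qf, mul_pow, h1, hl, h3]; ring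
    symm
    apply Finset.card_bij (fun y _ => l * y)
    · intro y hy; simp only [mem_filter, mem_univ, true_and] at hy ⊢; rw [hsc, hy, mul_one]
    · intro x _ y _ hxy; exact mul_left_cancel₀ hl0 hxy
    · intro y hy
      simp only [mem_filter, mem_univ, true_and] at hy
      refine ⟨l⁻¹ * y, ?_, by field_simp⟩
      simp only [mem_filter, mem_univ, true_and]
      have := hsc (l⁻¹ * y)
      rw [mul_inv_cancel_left₀ hl0, hy] at this
      exact mul_left_cancel₀ hm0 (by rw [mul_one]; exact this.symm)
  have htot := Finset.card_eq_sum_card_fiberwise (f := qf q a β) (s := univ)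
    (t := univ.filter fun y : F => y ^ q = y) (by
      intro y _; simpa using qf_frob q h hqh hF a β y hβ)
  rw [card_univ, hF, ← Finset.add_sum_erase _ _ (a := (0:F)) (by simp; omega),
    Finset.sum_congr rfl (g := fun _ => (univ.filter fun y => qf q a β y = 1).card),
    sum_const, card_erase_of_mem (by simp; omega), hS, smul_eq_mul, ← hscale k hk hk0] at htot
  · obtain ⟨p, rfl⟩ : ∃ p, q = p + 1 := ⟨q - 1, by omega⟩
    simp only [Nat.add_sub_cancel] at htot
    set A := (univ.filter fun y => qf (p+1) a β y = 0).card
    set B := (univ.filter fun y => qf (p+1) a β y = k).card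
    have hA : A = 2 * p + 1 := by omega
    rw [hA] at htot
    have : p * B = p * p := by linarith [htot, (show (p+1)^2 = p * p + 2 * p + 1 by ring)]
    have := Nat.eq_of_mul_eq_mul_left (by omega) this
    push_cast; rw [this]; ring
  · intro m hm
    simp only [mem_erase, mem_filter, mem_univ, true_and] at hm
    exact hscale m hm.2 hm.1

lemma qf_sum_count [CharP F 2] (q h : ℕ) (hqh : q = 2 ^ h) (hq : 2 ≤ q)
    (hF : Fintype.card F = q ^ 2) (a β : F) (ha : a ≠ 0) (hβ0 : β ≠ 0) (hβ : β ^ q = β)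
    (htr : ∑ i ∈ Finset.range h, (a ^ (q + 1) / β ^ 2) ^ 2 ^ i = 1) (n : ℕ) :
    ∀ (k : F), k ^ q = k →
    (q * (univ.filter fun x : Fin n → F => ∑ i, qf q a β (x i) = k).card : ℤ)
      = q ^ (2 * n) - q ^ n + if k = 0 then (q : ℤ) ^ (n + 1) else 0 := by
  have hadd : ∀ x y : F, (x + y) ^ q = x ^ q + y ^ q := by
    intro x y; rw [hqh]; exact add_pow_char_pow x y 2 h
  induction n with
  | zero =>
    intro k hk
    by_cases hk0 : k = 0
    · simp [hk0]
    · simp [hk0, Ne.symm hk0]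
  | succ n ih =>
    intro k hk
    have hdec : (univ.filter fun x : Fin (n + 1) → F => ∑ i, qf q a β (x i) = k).card
        = ∑ y : F, (univ.filter fun x : Fin n → F => ∑ i, qf q a β (x i) = k + qf q a β y).card := by
      simp only [Finset.card_filter]
      rw [← Fintype.sum_prod_type', ← (Fin.consEquiv (fun _ : Fin (n+1) => F)).sum_comp]
      apply Finset.sum_congr rfl
      intro p _
      congr 1
      simp only [Fin.consEquiv_apply, Fin.sum_univ_succ, Fin.cons_zero, Fin.cons_succ, eq_iff_iff]
      constructor
      · rintro rfl
        linear_combination (- qf q a β p.1) * (CharTwo.two_eq_zero : (2 : F) = 0)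
      · intro hh
        rw [hh]
        linear_combination (qf q a β p.1) * (CharTwo.two_eq_zero : (2 : F) = 0)
    rw [hdec]
    push_cast
    rw [Finset.mul_sum, Finset.sum_congr rfl (fun y _ => ih (k + qf q a β y) (by
      rw [hadd, hk, qf_frob q h hqh hF a β y hβ])), Finset.sum_add_distrib, sum_const, card_univ, hF,
      ← Finset.sum_filter, sum_const]
    have : (univ.filter fun y => k + qf q a β y = 0) = univ.filter fun y => qf q a β y = k := by
      ext y; simp only [mem_filter, mem_univ, true_and, CharTwo.add_eq_zero]; exact eq_comm
    rw [this]
    simp only [nsmul_eq_mul]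
    rw [qf_count q h hqh hq hF a β ha hβ0 hβ htr k hk]
    split_ifs <;> push_cast <;> ring

lemma mem_BSet [CharP F 2] (q r : ℕ) (a b : F) (x : (Fin (r - 1) → F) × F) :
    x ∈ BSet q r a b ↔ x.2 ^ q + 1 * x.2 = ∑ i, qf q a (b ^ q + b) (x.1 i) := by
  simp only [BSet, Set.mem_setOf_eq, qf, Finset.sum_add_distrib, ← Finset.mul_sum,
    CharTwo.sub_eq_add, one_mul]
  have h2 : (2 : F) = 0 := CharTwo.two_eq_zero
  constructor
  · intro hh
    linear_combination hh - (a ^ q * (∑ i, x.1 i ^ (2 * q)) + a * (∑ i, x.1 i ^ 2)) * h2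
  · intro hh
    linear_combination hh + (a ^ q * (∑ i, x.1 i ^ (2 * q)) + a * (∑ i, x.1 i ^ 2)) * h2

lemma cyl_count [CharP F 2] (q r h : ℕ) (hqh : q = 2 ^ h) (hq : 2 ≤ q)
    (hF : Fintype.card F = q ^ 2) (a b : F) (P : (Fin (r - 1) → F) → Prop) [DecidablePred P] :
    ({x : (Fin (r - 1) → F) × F | P x.1} ∩ BSet q r a b).ncard
      = (univ.filter P).card * q := by
  have hadd : ∀ x y : F, (x + y) ^ q = x ^ q + y ^ q := by
    intro x y; rw [hqh]; exact add_pow_char_pow x y 2 h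
  have hqq : ∀ x : F, (x ^ q) ^ q = x := by
    intro x; rw [← pow_mul, ← sq, ← hF]; exact FiniteField.pow_card x
  have hsum : ∀ x : Fin (r - 1) → F, (∑ i, qf q a (b ^ q + b) (x i)) ^ q
      = ∑ i, qf q a (b ^ q + b) (x i) := by
    intro x
    have h1 : (∑ i, qf q a (b ^ q + b) (x i)) ^ q = ∑ i, (qf q a (b ^ q + b) (x i)) ^ q := by
      rw [hqh]; exact sum_pow_char_pow 2 h _ _
    rw [h1]
    exact Finset.sum_congr rfl fun i _ => qf_frob q h hqh hF a _ (x i) (by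
      rw [hadd, hqq, add_comm])
  have hset : {x : (Fin (r - 1) → F) × F | P x.1} ∩ BSet q r a b
      = ((univ.filter fun x : (Fin (r - 1) → F) × F =>
        P x.1 ∧ x.2 ^ q + 1 * x.2 = ∑ i, qf q a (b ^ q + b) (x.1 i) : Finset _) : Set _) := by
    ext x; simp only [Set.mem_inter_iff, mem_BSet]; simp
  rw [hset, Set.ncard_coe_finset, Finset.card_filter, Fintype.sum_prod_type, Finset.card_filter,
    Finset.sum_mul]
  apply Finset.sum_congr rfl
  intro x _
  rw [← Finset.card_filter]
  by_cases hP : P x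
  · simp only [hP, true_and, if_true, one_mul]
    have := fiber_q q h hqh hq hF 1 (∑ i, qf q a (b ^ q + b) (x i)) (by simp)
      (by rw [hsum]; simp)
    simpa only [one_mul] using this
  · simp [hP]

lemma lin_count (n : ℕ) (c : Fin n → F) (hc : c ≠ 0) (d : F) :
    (univ.filter fun x : Fin n → F => ∑ i, c i * x i = d).card * Fintype.card F
      = Fintype.card F ^ n := by
  obtain ⟨j, hj⟩ := Function.ne_iff.1 hc
  have hj : c j ≠ 0 := hj
  let φ : (Fin n → F) →+ F :=
    { toFun := fun x => ∑ i, c i * x i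
      map_zero' := by simp
      map_add' := fun x y => by simp [mul_add, Finset.sum_add_distrib] }
  have hs : Function.Surjective φ := by
    intro z
    refine ⟨Pi.single j (z / c j), ?_⟩
    change ∑ i, c i * (Pi.single j (z / c j) : Fin n → F) i = z
    rw [Finset.sum_eq_single j]
    · simp; field_simp
    · intro i _ hi; simp [hi]
    · simp
  have := fiber_mul φ d (hs d)
  rw [Finset.image_univ_of_surjective hs, card_univ, Fintype.card_fun, Fintype.card_fin] at this
  exact this

lemma graph_count [CharP F 2] (q r h : ℕ) (hqh : q = 2 ^ h) (hq : 2 ≤ q)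
    (hF : Fintype.card F = q ^ 2) (a b : F) (hβ0 : b ^ q + b ≠ 0)
    (c : Fin (r - 1) → F) (c0 d : F) (hc0 : c0 ≠ 0) :
    ∃ k : F, k ^ q = k ∧
    ({x : (Fin (r - 1) → F) × F | (∑ i, c i * x.1 i) + c0 * x.2 = d} ∩ BSet q r a b).ncard
      = (univ.filter fun x : Fin (r - 1) → F => ∑ i, qf q a (b ^ q + b) (x i) = k).card := by
  have h2 : (2 : F) = 0 := CharTwo.two_eq_zero
  have hadd : ∀ x y : F, (x + y) ^ q = x ^ q + y ^ q := by
    intro x y; rw [hqh]; exact add_pow_char_pow x y 2 h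
  have hqq : ∀ x : F, (x ^ q) ^ q = x := by
    intro x; rw [← pow_mul, ← sq, ← hF]; exact FiniteField.pow_card x
  have hsumq : ∀ g : Fin (r - 1) → F, (∑ i, g i) ^ q = ∑ i, g i ^ q := by
    intro g; rw [hqh]; exact sum_pow_char_pow 2 h _ _
  have hβ : (b ^ q + b) ^ q = b ^ q + b := by rw [hadd, hqq, add_comm]
  set β := b ^ q + b with hβdef
  let m : Fin (r - 1) → F := fun i => c i / c0
  let e : F := d / c0
  let w : Fin (r - 1) → F := fun i => (m i / β) ^ q
  have hw : ∀ i, β * w i ^ q = m i := by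
    intro i; simp only [w, hqq]; field_simp
  have hw' : ∀ i, β * w i = m i ^ q := by
    intro i; simp only [w, div_pow, hβ]; field_simp
  have hpol : ∀ i y, qf q a β (y + w i) = qf q a β y + qf q a β (w i)
      + (m i * y + (m i * y) ^ q) := by
    intro i y
    have p1 : (y + w i) ^ (2 * q) = y ^ (2 * q) + w i ^ (2 * q) := by
      rw [mul_comm, pow_mul, hadd, CharTwo.add_sq, ← pow_mul, ← pow_mul]
    simp only [qf, p1, CharTwo.add_sq, pow_succ _ q, hadd, mul_pow]
    rw [← hw' i, ← hw i]
    ring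
  have hpolS : ∀ y : Fin (r - 1) → F, ∑ i, qf q a β (y i + w i) = ∑ i, qf q a β (y i)
      + ∑ i, qf q a β (w i) + ((∑ i, m i * y i) + (∑ i, m i * y i) ^ q) := by
    intro y
    rw [hsumq]
    simp only [hpol, Finset.sum_add_distrib]
  let L := ∑ i, m i * w i
  let k : F := ∑ i, qf q a β (w i) + ((e + L) ^ q + (e + L))
  refine ⟨k, ?_, ?_⟩
  · simp only [k, hadd, hsumq, hqq, qf_frob q h hqh hF a β _ hβ]; ring
  · let g : (Fin (r - 1) → F) → (Fin (r - 1) → F) × F :=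
      fun x => (fun i => x i + w i, e + (L + ∑ i, m i * x i))
    have hginj : Function.Injective g := by
      intro x y hxy
      have := congrArg Prod.fst hxy
      funext i
      exact add_right_cancel (congrFun this i)
    rw [← Set.ncard_coe_finset, ← Set.ncard_image_of_injective _ hginj]
    congr 1
    have hkey : ∀ x, g x ∈ BSet q r a b ↔ ∑ i, qf q a β (x i) = k := by
      intro x
      rw [mem_BSet]
      simp only [g, ← hβdef, hpolS, k]
      simp only [hadd]
      constructor
      · intro hh
        linear_combination -hh - (∑ i, qf q a β (w i)) * h2
      · intro hh
        linear_combination -hh - (∑ i, qf q a β (w i)) * h2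
    have hlin : ∀ x : Fin (r - 1) → F, ∑ i, c i * x i = c0 * ∑ i, m i * x i := by
      intro x
      rw [Finset.mul_sum]
      refine Finset.sum_congr rfl fun i _ => ?_
      simp only [m]; field_simp
    have hd : d = c0 * e := by simp only [e]; field_simp
    ext ⟨x, z⟩
    simp only [Set.mem_inter_iff, Set.mem_setOf_eq, Set.mem_image, coe_filter, mem_univ, true_and]
    constructor
    · rintro ⟨h1, h3⟩
      have hx : g (fun i => x i + w i) = (x, z) := by
        have hz : z = e + ∑ i, m i * x i := by
          rw [hlin, ← mul_add, hd] at h1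
          have := mul_left_cancel₀ hc0 h1
          linear_combination this - (∑ i, m i * x i) * h2
        simp only [g, Prod.mk.injEq]
        constructor
        · funext i; linear_combination w i * h2
        · rw [hz]; simp only [mul_add, Finset.sum_add_distrib]
          change e + (L + (_ + L)) = _
          linear_combination L * h2
      exact ⟨_, (hkey _).1 (hx ▸ h3), hx⟩
    · rintro ⟨y, hy, hyg⟩
      refine ⟨?_, hyg ▸ (hkey y).2 hy⟩
      have e1 : (fun i => y i + w i) = x := congrArg Prod.fst hyg
      have e2 : e + (L + ∑ i, m i * y i) = z := congrArg Prod.snd hyg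
      rw [hlin, ← e1, ← e2, hd]
      simp only [mul_add, Finset.sum_add_distrib]
      change c0 * (∑ i, m i * y i) + c0 * L + _ = _
      linear_combination (c0 * (∑ i, m i * y i) + c0 * L) * h2

end helpers

/-- for `q = 2^h` an even prime power, `r ≥ 2` even, and
`Tr_q(a^{q+1}/(b^q + b)²) = 1` (absolute trace `GF(q) → GF(2)`,
`x ↦ x + x² + ⋯ + x^{2^{h−1}}`), the set `B(a,b)` has `q^{2r−1}` points and its
characters with respect to affine hyperplanes are among
`q^{2r−3} − q^{r−2}`, `q^{2r−3}`, `q^{2r−3} − q^{r−2} + q^{r−1}`. -/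
theorem statement8 (q r h : ℕ) (hq : IsPrimePow q) (hqh : q = 2 ^ h)
    (hr : 2 ≤ r) (hreven : Even r)
    {F : Type*} [Field F] [Fintype F] (hF : Fintype.card F = q ^ 2)
    (a b : F) (ha : a ≠ 0) (hb : b ^ q ≠ b)
    (htr : ∑ i ∈ Finset.range h, (a ^ (q + 1) / (b ^ q + b) ^ 2) ^ 2 ^ i = 1) :
    (BSet q r a b).ncard = q ^ (2 * r - 1) ∧
    ∀ (c : Fin (r - 1) → F) (c0 d : F), ¬(c = 0 ∧ c0 = 0) →
      (({x : (Fin (r - 1) → F) × F | (∑ i, c i * x.1 i) + c0 * x.2 = d}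
          ∩ BSet q r a b)).ncard ∈
        ({q ^ (2 * r - 3) - q ^ (r - 2), q ^ (2 * r - 3),
          q ^ (2 * r - 3) - q ^ (r - 2) + q ^ (r - 1)} : Set ℕ) := by
  classical
  have hq1 : 1 < q := hq.one_lt
  have hh : h ≠ 0 := by rintro rfl; simp at hqh; omega
  have hcp : CharP F 2 := by
    have : Fact (Nat.Prime 2) := ⟨Nat.prime_two⟩
    refine charP_of_card_eq_prime_pow (f := h * 2) ?_
    rw [hF, hqh, pow_mul]
  have hβ0 : b ^ q + b ≠ 0 := fun h0 => hb (CharTwo.add_eq_zero.1 h0)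
  have hβ : (b ^ q + b) ^ q = b ^ q + b := by
    have h1 : (b ^ q + b) ^ q = (b ^ q) ^ q + b ^ q := by
      conv_lhs => rw [hqh]
      rw [add_pow_char_pow, ← hqh]
    rw [h1, ← pow_mul, ← sq, ← hF, FiniteField.pow_card, add_comm]
  obtain ⟨m, rfl⟩ : ∃ m, r = m + 2 := ⟨r - 2, by omega⟩
  constructor
  · have := cyl_count q (m + 2) h hqh hq1 hF a b (fun _ => True)
    rw [Set.setOf_true, Set.univ_inter] at this
    rw [this, Finset.filter_true, card_univ, Fintype.card_fun, Fintype.card_fin, hF, ← pow_mul,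
      ← pow_succ]
    congr 1
  · intro c c0 d hcc
    have x1 : 2 * (m + 2) - 3 = 2 * m + 1 := by omega
    have x2 : m + 2 - 2 = m := by omega
    have x3 : m + 2 - 1 = m + 1 := by omega
    rw [x1, x2]
    by_cases hc0 : c0 = 0
    · have hc : c ≠ 0 := fun h0 => hcc ⟨h0, hc0⟩
      have hl := lin_count _ c hc d
      right; left
      subst hc0
      simp only [zero_mul, add_zero]
      rw [cyl_count q (m + 2) h hqh hq1 hF a b (fun x => ∑ i, c i * x i = d), pow_succ]
      congr 1
      rw [hF, show (q ^ 2) ^ (m + 2 - 1) = (q ^ 2) ^ m * q ^ 2 from pow_succ (q ^ 2) m] at hl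
      rw [Nat.eq_of_mul_eq_mul_right (by positivity) hl, ← pow_mul]
    · obtain ⟨k, hk, hcount⟩ := graph_count q (m + 2) h hqh hq1 hF a b hβ0 c c0 d hc0
      have hs := qf_sum_count q h hqh hq1 hF a (b ^ q + b) ha hβ0 hβ htr (m + 2 - 1) k hk
      rw [← hcount] at hs
      generalize Set.ncard _ = N at hs ⊢
      rw [x3] at hs ⊢
      have hle : q ^ m ≤ q ^ (2 * m + 1) := Nat.pow_le_pow_right (by omega) (by omega)
      have hqz : (q : ℤ) ≠ 0 := by positivity
      split_ifs at hs with hk0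
      · right; right
        rw [Set.mem_singleton_iff]
        zify [hle]
        apply mul_left_cancel₀ hqz
        rw [hs]; ring
      · left
        zify [hle]
        apply mul_left_cancel₀ hqz
        rw [hs]; ring
end
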